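/- Let n ≥ 1 and let S ⊆ ℝ^n be a Borel set with S ∩ (−S) = ∅ and 0 < Vol_n(S) < ∞. Let μ be any SL_n(ℝ)-invariant Borel probability measure on the space 𝒳_n of covolume-one lattices in ℝ^n. Let f be a bounded Borel function on the finite subsets of S such that f(X) = 0 whenever |X| ≥ n. Then ∫_{𝒳_n} ( Σ_{X ⊆ L ∩ S} f(X)·ι(X) ) dμ(L) = Σ_{ℓ=0}^{n−1} (1/ℓ!) ∫_{S^ℓ} f({x_1, …, x_ℓ}) dx_1⋯dx_ℓ, where on the left the sum runs over all subsets X of L ∩ S (the integrand being defined for μ-almost every L, since L ∩ S is finite for μ-almost every L), and the ℓ = 0 term on the right equals f(∅). -/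

import Mathlib

open MeasureTheory Pointwise
open scoped ENNReal

noncomputable section

/-- `SL(n, ℝ)`, the special linear group of `n × n` real matrices of determinant one. -/
abbrev SLR (n : ℕ) := Matrix.SpecialLinearGroup (Fin n) ℝ

/-- The topology on `SL(n, ℝ)` induced from the space of matrices. -/
instance (n : ℕ) : TopologicalSpace (SLR n) :=
  TopologicalSpace.induced (fun g => (g : Matrix (Fin n) (Fin n) ℝ)) inferInstance

/-- The subgroup `SL(n, ℤ)` of `SL(n, ℝ)` (the range of the coefficient-wise
integer-to-real map on special linear groups). -/
def SLZ (n : ℕ) : Subgroup (SLR n) :=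
  MonoidHom.range (Matrix.SpecialLinearGroup.map (n := Fin n) (Int.castRingHom ℝ))

/-- The space `𝒳ₙ = SL(n, ℝ) / SL(n, ℤ)` of lattices of covolume one in `ℝⁿ`. -/
def LatticeSpace (n : ℕ) := SLR n ⧸ SLZ n

instance (n : ℕ) : TopologicalSpace (LatticeSpace n) :=
  inferInstanceAs (TopologicalSpace (SLR n ⧸ SLZ n))

/-- The Borel σ-algebra on the space of lattices. -/
instance (n : ℕ) : MeasurableSpace (LatticeSpace n) := borel _

/-- The action of `SL(n, ℝ)` on the space of lattices, `g.L = {g x : x ∈ L}`. -/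
instance (n : ℕ) : MulAction (SLR n) (LatticeSpace n) :=
  inferInstanceAs (MulAction (SLR n) (SLR n ⧸ SLZ n))

/-- The lattice `{g v : v ∈ ℤⁿ} ⊆ ℝⁿ` associated to a point of `LatticeSpace n`,
computed via a representative `g` of the coset (the resulting set of vectors does not
depend on the choice of representative, since `SL(n, ℤ)` preserves `ℤⁿ`). -/
def latticeOf {n : ℕ} (L : LatticeSpace n) : Set (Fin n → ℝ) :=
  {y | ∃ v : Fin n → ℤ,
    y = (Quotient.out (α := SLR n) L).1.mulVec (fun i => (v i : ℝ))}

/-- A set `X ⊆ ℝⁿ` consists of linearly independent vectors. -/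
def indepSet {n : ℕ} (X : Set (Fin n → ℝ)) : Prop :=
  LinearIndependent ℝ (fun x : X => (x : Fin n → ℝ))

open scoped Classical in
/-- `ι(X) = 1` if the vectors of `X` are linearly independent and `ι(X) = 0` otherwise
(in particular `ι(∅) = 1` and `ι({0}) = 0`). -/
def iota {n : ℕ} (X : Set (Fin n → ℝ)) : ℝ :=
  if indepSet X then 1 else 0

theorem continuous_coe_SLR (n : ℕ) : Continuous fun g : SLR n => (g : Matrix (Fin n) (Fin n) ℝ) :=
  continuous_induced_dom

theorem continuous_entry_SLR {n : ℕ} (i j : Fin n) : Continuous fun g : SLR n => g.1 i j :=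
  (continuous_coe_SLR n).matrix_elem i j

instance (n : ℕ) : IsTopologicalGroup (SLR n) :=
  Matrix.SpecialLinearGroup.topologicalGroup

theorem isClosedEmbedding_coe_SLR (n : ℕ) :
    Topology.IsClosedEmbedding fun g : SLR n => (g : Matrix (Fin n) (Fin n) ℝ) := by
  refine ⟨⟨⟨rfl⟩, Subtype.val_injective⟩, ?_⟩
  have : (Set.range fun g : SLR n => (g : Matrix (Fin n) (Fin n) ℝ)) = {A | A.det = 1} :=
    Subtype.range_val
  rw [this]
  exact isClosed_eq (Continuous.matrix_det continuous_id) continuous_const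

instance (n : ℕ) : PolishSpace (SLR n) := by
  have : PolishSpace (Matrix (Fin n) (Fin n) ℝ) :=
    inferInstanceAs (PolishSpace (Fin n → Fin n → ℝ))
  exact (isClosedEmbedding_coe_SLR n).polishSpace

instance (n : ℕ) : MeasurableSpace (SLR n) := borel _

instance (n : ℕ) : BorelSpace (SLR n) := ⟨rfl⟩

instance (n : ℕ) : BorelSpace (LatticeSpace n) := ⟨rfl⟩

theorem mem_SLZ_iff {n : ℕ} {g : SLR n} : g ∈ SLZ n ↔ ∀ i j, ∃ k : ℤ, g.1 i j = k := by
  constructor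
  · rintro ⟨h, rfl⟩ i j
    exact ⟨h.1 i j, rfl⟩
  · intro h
    choose A hA using h
    have hg : g.1 = (Matrix.of A).map (Int.castRingHom ℝ) := by
      ext i j; simp [hA]
    refine ⟨⟨Matrix.of A, ?_⟩, ?_⟩
    · have h1 := g.2
      rw [hg, ← RingHom.mapMatrix_apply, ← RingHom.map_det] at h1
      exact Int.cast_injective (α := ℝ) (by simpa using h1)
    · apply Subtype.ext
      exact hg.symm

instance (n : ℕ) : Countable (SLZ n) := by
  have : Countable (Matrix.SpecialLinearGroup (Fin n) ℤ) := by
    have : Countable (Matrix (Fin n) (Fin n) ℤ) :=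
      inferInstanceAs (Countable (Fin n → Fin n → ℤ))
    exact Subtype.countable
  exact (Set.countable_range _).to_subtype

instance (n : ℕ) : IsClosed (SLZ n : Set (SLR n)) := by
  have : (SLZ n : Set (SLR n)) =
      ⋂ i, ⋂ j, (fun g : SLR n => g.1 i j) ⁻¹' Set.range ((↑) : ℤ → ℝ) := by
    ext g
    simp [mem_SLZ_iff, eq_comm]
  rw [this]
  exact isClosed_iInter fun i => isClosed_iInter fun j =>
    (Int.isClosedEmbedding_coe_real.isClosed_range).preimage (continuous_entry_SLR i j)

/-- The projection `SL(n, ℝ) → 𝒳ₙ`. -/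
def toLattice {n : ℕ} (g : SLR n) : LatticeSpace n := QuotientGroup.mk (s := SLZ n) g

theorem continuous_toLattice (n : ℕ) : Continuous (toLattice (n := n)) :=
  QuotientGroup.continuous_mk (N := SLZ n)

theorem toLattice_out {n : ℕ} (L : LatticeSpace n) :
    toLattice (Quotient.out (α := SLR n) L) = L := Quotient.out_eq _

theorem surjective_toLattice (n : ℕ) : Function.Surjective (toLattice (n := n)) :=
  fun L => ⟨_, toLattice_out L⟩

theorem toLattice_eq_iff {n : ℕ} {g h : SLR n} : toLattice g = toLattice h ↔ g⁻¹ * h ∈ SLZ n :=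
  QuotientGroup.eq

theorem smul_toLattice {n : ℕ} (g h : SLR n) : g • toLattice h = toLattice (g * h) := rfl

theorem exists_out_toLattice {n : ℕ} (g : SLR n) :
    ∃ γ : SLZ n, Quotient.out (α := SLR n) (toLattice g) = g * γ := by
  refine ⟨⟨g⁻¹ * Quotient.out (α := SLR n) (toLattice g), ?_⟩, by simp⟩
  rw [← toLattice_eq_iff, toLattice_out]

theorem map_toLattice_eq_borel (n : ℕ) :
    (inferInstance : MeasurableSpace (SLR n)).map toLattice = borel (LatticeSpace n) := by
  have : T2Space (LatticeSpace n) := inferInstanceAs (T2Space (SLR n ⧸ SLZ n))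
  have : SecondCountableTopology (LatticeSpace n) :=
    inferInstanceAs (SecondCountableTopology (SLR n ⧸ SLZ n))
  exact (continuous_toLattice n).map_borel_eq (surjective_toLattice n)

theorem measurable_of_comp_toLattice {n : ℕ} {β : Type*} [MeasurableSpace β]
    {φ : LatticeSpace n → β} (h : Measurable fun g => φ (toLattice g)) : Measurable φ := by
  intro A hA
  change MeasurableSet[borel (LatticeSpace n)] _
  rw [← map_toLattice_eq_borel]
  exact h hA

theorem measurable_toLattice (n : ℕ) : Measurable (toLattice (n := n)) :=
  (continuous_toLattice n).measurable

theorem continuous_smul_lattice {n : ℕ} (g : SLR n) :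
    Continuous fun x : LatticeSpace n => g • x := by
  have := QuotientGroup.instContinuousConstSMul (G := SLR n) (N := SLZ n)
  exact this.continuous_const_smul g

theorem toLattice_mul_mem {n : ℕ} (g : SLR n) (γ : SLZ n) :
    toLattice (g * (γ : SLR n)) = toLattice g := by
  rw [eq_comm, toLattice_eq_iff]; simp

/-- The counting measure on the fibre of `SL(n, ℝ) → 𝒳ₙ` over a point. -/
def fiberMeasure {n : ℕ} (L : LatticeSpace n) : Measure (SLR n) :=
  Measure.sum fun γ : SLZ n => Measure.dirac (Quotient.out (α := SLR n) L * (γ : SLR n))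

theorem lintegral_fiberMeasure {n : ℕ} (g : SLR n) {ψ : SLR n → ℝ≥0∞} (hψ : Measurable ψ) :
    ∫⁻ h, ψ h ∂(fiberMeasure (toLattice g)) = ∑' γ : SLZ n, ψ (g * (γ : SLR n)) := by
  obtain ⟨γ₀, h₀⟩ := exists_out_toLattice g
  rw [fiberMeasure, lintegral_sum_measure, h₀]
  simp_rw [lintegral_dirac' _ hψ]
  rw [← (Equiv.mulLeft γ₀).tsum_eq fun γ : SLZ n => ψ (g * (γ : SLR n))]
  simp [mul_assoc]

theorem measurable_fiberMeasure (n : ℕ) : Measurable (fiberMeasure (n := n)) := by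
  refine Measure.measurable_of_measurable_coe _ fun A hA => measurable_of_comp_toLattice ?_
  have : ∀ g : SLR n, fiberMeasure (toLattice g) A =
      ∑' γ : SLZ n, A.indicator (1 : SLR n → ℝ≥0∞) (g * (γ : SLR n)) := fun g => by
    rw [← lintegral_fiberMeasure g (measurable_one.indicator hA), lintegral_indicator_one hA]
  simp_rw [this]
  exact Measurable.tsum fun γ =>
    (measurable_one.indicator hA).comp (measurable_mul_const _)

/-- The lift to `SL(n, ℝ)` of a measure on the space of lattices. -/
def liftMeasure {n : ℕ} (μ : Measure (LatticeSpace n)) : Measure (SLR n) := μ.bind fiberMeasure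

theorem lintegral_liftMeasure {n : ℕ} (μ : Measure (LatticeSpace n)) {ψ : SLR n → ℝ≥0∞}
    (hψ : Measurable ψ) :
    ∫⁻ g, ψ g ∂(liftMeasure μ) = ∫⁻ L, ∫⁻ g, ψ g ∂(fiberMeasure L) ∂μ :=
  Measure.lintegral_bind (measurable_fiberMeasure n).aemeasurable hψ.aemeasurable

theorem lintegral_smul_lattice {n : ℕ} {μ : Measure (LatticeSpace n)}
    (hinv : ∀ g : SLR n, Measure.map (fun x => g • x) μ = μ) (g : SLR n)
    {φ : LatticeSpace n → ℝ≥0∞} (hφ : Measurable φ) :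
    ∫⁻ L, φ (g • L) ∂μ = ∫⁻ L, φ L ∂μ := by
  conv_rhs => rw [← hinv g, lintegral_map hφ (continuous_smul_lattice g).measurable]

theorem isMulLeftInvariant_liftMeasure {n : ℕ} {μ : Measure (LatticeSpace n)}
    (hinv : ∀ g : SLR n, Measure.map (fun x => g • x) μ = μ) :
    (liftMeasure μ).IsMulLeftInvariant := by
  refine ⟨fun h => ?_⟩
  refine Measure.ext_of_lintegral _ fun ψ hψ => ?_
  rw [lintegral_map hψ (measurable_const_mul h),
    lintegral_liftMeasure (ψ := fun g => ψ (h * g)) _ (hψ.comp (measurable_const_mul h)),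
    lintegral_liftMeasure _ hψ,
    ← lintegral_smul_lattice (φ := fun L => ∫⁻ g, ψ g ∂(fiberMeasure L)) hinv h
      ((Measure.measurable_lintegral hψ).comp (measurable_fiberMeasure n))]
  refine lintegral_congr fun L => ?_
  obtain ⟨g, rfl⟩ := surjective_toLattice n L
  rw [smul_toLattice]
  rw [lintegral_fiberMeasure _ hψ,
    lintegral_fiberMeasure (ψ := fun g => ψ (h * g)) g (hψ.comp (measurable_const_mul h))]
  simp [mul_assoc]

/-- The elements of `SL(n, ℝ)` which, together with their inverses, have entries bounded by `i`. -/
def boundedSLR (n i : ℕ) : Set (SLR n) :=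
  {g | ∀ a b, |g.1 a b| ≤ i ∧ |(g⁻¹).1 a b| ≤ i}

theorem isClosed_boundedSLR (n i : ℕ) : IsClosed (boundedSLR n i) := by
  simp only [boundedSLR, Set.ofPred_forall]
  refine isClosed_iInter fun a => isClosed_iInter fun b => ?_
  exact (isClosed_le (continuous_entry_SLR a b).abs continuous_const).inter
    (isClosed_le ((continuous_entry_SLR a b).comp continuous_inv).abs continuous_const)

theorem exists_mem_boundedSLR {n : ℕ} (g : SLR n) : ∃ i, g ∈ boundedSLR n i := by
  obtain ⟨i, hi⟩ := exists_nat_ge (∑ a, ∑ b, (|g.1 a b| + |(g⁻¹).1 a b|))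
  refine ⟨i, fun a b => ?_⟩
  have h1 : |g.1 a b| + |(g⁻¹).1 a b| ≤ ∑ a, ∑ b, (|g.1 a b| + |(g⁻¹).1 a b|) :=
    (Finset.single_le_sum (f := fun b => |g.1 a b| + |(g⁻¹).1 a b|)
      (fun _ _ => by positivity) (Finset.mem_univ b)).trans
    (Finset.single_le_sum (f := fun a => ∑ b, (|g.1 a b| + |(g⁻¹).1 a b|))
      (fun _ _ => by positivity) (Finset.mem_univ a))
  have := abs_nonneg (g.1 a b)
  have := abs_nonneg ((g⁻¹).1 a b)
  constructor <;> linarith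

theorem abs_mul_entry_le {n : ℕ} {A B : Matrix (Fin n) (Fin n) ℝ} {x y : ℝ}
    (hA : ∀ a b, |A a b| ≤ x) (hB : ∀ a b, |B a b| ≤ y) (a b : Fin n) :
    |(A * B) a b| ≤ n * (x * y) := by
  rw [Matrix.mul_apply]
  refine (Finset.abs_sum_le_sum_abs _ _).trans ?_
  refine (Finset.sum_le_card_nsmul _ _ (x * y) fun c _ => ?_).trans (by simp)
  rw [abs_mul]
  exact mul_le_mul (hA a c) (hB c b) (abs_nonneg _) ((abs_nonneg _).trans (hA a c))

theorem finite_bounded_SLZ (n : ℕ) (r : ℝ) :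
    {γ : SLZ n | ∀ a b, |(γ : SLR n).1 a b| ≤ r}.Finite := by
  have hfin : (Set.univ.pi fun _ : Fin n => Set.univ.pi fun _ : Fin n =>
      ((↑) : ℤ → ℝ) '' (Set.Icc ⌈-r⌉ ⌊r⌋)).Finite :=
    Set.Finite.pi fun _ => Set.Finite.pi fun _ => (Set.finite_Icc _ _).image _
  refine Set.Finite.of_finite_image (f := fun γ : SLZ n => fun a b => (γ : SLR n).1 a b)
    (hfin.subset ?_) ?_
  · rintro _ ⟨γ, hγ, rfl⟩ a - b -
    obtain ⟨k, hk⟩ := mem_SLZ_iff.1 γ.2 a b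
    have := abs_le.1 (hγ a b)
    refine ⟨k, ⟨?_, ?_⟩, hk.symm⟩
    · rw [Int.ceil_le, ← hk]; exact this.1
    · rw [Int.le_floor, ← hk]; exact this.2
  · intro γ _ γ' _ h
    apply Subtype.ext; apply Subtype.ext
    exact h

theorem exists_fiberMeasure_boundedSLR_le (n i : ℕ) :
    ∃ C : ℕ, ∀ L : LatticeSpace n, fiberMeasure L (boundedSLR n i) ≤ C := by
  have hmeas : MeasurableSet (boundedSLR n i) := (isClosed_boundedSLR n i).measurableSet
  set T := {γ : SLZ n | ∀ a b, |(γ : SLR n).1 a b| ≤ n * ((i : ℝ) * i)} with hT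
  have hTfin : T.Finite := finite_bounded_SLZ _ _
  refine ⟨T.ncard, fun L => ?_⟩
  obtain ⟨g, rfl⟩ := surjective_toLattice n L
  by_cases hex : ∃ γ₀ : SLZ n, g * (γ₀ : SLR n) ∈ boundedSLR n i
  swap
  · have : fiberMeasure (toLattice g) (boundedSLR n i) = 0 := by
      rw [← lintegral_indicator_one hmeas,
        lintegral_fiberMeasure _ (measurable_one.indicator hmeas)]
      simp only [ENNReal.tsum_eq_zero]
      intro γ
      exact Set.indicator_of_notMem (fun h => hex ⟨γ, h⟩) _
    simp [this]
  obtain ⟨γ₀, h₀⟩ := hex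
  rw [← toLattice_mul_mem g γ₀, ← lintegral_indicator_one hmeas,
    lintegral_fiberMeasure _ (measurable_one.indicator hmeas)]
  set h := g * (γ₀ : SLR n)
  calc ∑' γ : SLZ n, (boundedSLR n i).indicator (1 : SLR n → ℝ≥0∞) (h * (γ : SLR n))
      ≤ ∑' γ : SLZ n, T.indicator 1 γ := by
        refine ENNReal.tsum_le_tsum fun γ => ?_
        by_cases hγ : h * (γ : SLR n) ∈ boundedSLR n i
        · have : γ ∈ T := fun a b => by
            have := abs_mul_entry_le (fun a b => (h₀ a b).2) (fun a b => (hγ a b).1) a b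
            rwa [← Matrix.SpecialLinearGroup.coe_mul, inv_mul_cancel_left] at this
          simp [this, hγ]
        · simp [hγ]
    _ = T.encard := by
        rw [← tsum_subtype]
        simp
    _ ≤ T.ncard := by
        rw [← hTfin.cast_ncard_eq]; simp

theorem lintegral_lintegral_fiberMeasure {n : ℕ} (μ : Measure (LatticeSpace n))
    {u : SLR n → ℝ≥0∞} (hu : Measurable u) {φ : LatticeSpace n → ℝ≥0∞} (hφ : Measurable φ) :
    ∫⁻ g, φ (toLattice g) * u g ∂(liftMeasure μ) =
      ∫⁻ L, φ L * ∫⁻ g, u g ∂(fiberMeasure L) ∂μ := by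
  have hφ' := hφ.comp (measurable_toLattice n)
  rw [lintegral_liftMeasure (ψ := fun g => φ (toLattice g) * u g) _ (hφ'.mul hu)]
  refine lintegral_congr fun L => ?_
  obtain ⟨g, rfl⟩ := surjective_toLattice n L
  rw [lintegral_fiberMeasure (ψ := fun g => φ (toLattice g) * u g) _ (hφ'.mul hu),
    lintegral_fiberMeasure _ hu, ← ENNReal.tsum_mul_left]
  simp_rw [toLattice_mul_mem]

theorem exists_fiber_weight (n : ℕ) : ∃ u : SLR n → ℝ≥0∞, Measurable u ∧
    ∀ L : LatticeSpace n, ∫⁻ g, u g ∂(fiberMeasure L) ≠ 0 ∧ ∫⁻ g, u g ∂(fiberMeasure L) ≠ ∞ := by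
  choose C hC using exists_fiberMeasure_boundedSLR_le n
  have hmeas : ∀ i, MeasurableSet (boundedSLR n i) :=
    fun i => (isClosed_boundedSLR n i).measurableSet
  have hmeas' : ∀ i, Measurable ((boundedSLR n i).indicator
    fun _ => (2⁻¹ : ℝ≥0∞) ^ i * (C i + 1 : ℝ≥0∞)⁻¹) := fun i => measurable_const.indicator (hmeas i)
  refine ⟨fun g => ∑' i, (boundedSLR n i).indicator
    (fun _ => (2⁻¹ : ℝ≥0∞) ^ i * (C i + 1 : ℝ≥0∞)⁻¹) g, Measurable.tsum hmeas', fun L => ?_⟩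
  constructor
  · obtain ⟨g, rfl⟩ := surjective_toLattice n L
    rw [lintegral_fiberMeasure _ (Measurable.tsum hmeas')]
    simp only [ne_eq, ENNReal.tsum_eq_zero, not_forall]
    obtain ⟨i, hi⟩ := exists_mem_boundedSLR g
    refine ⟨1, i, ?_⟩
    simp [hi, ENNReal.add_eq_top]
  · rw [lintegral_tsum fun i => (hmeas' i).aemeasurable]
    have : ∑' i, ∫⁻ g, (boundedSLR n i).indicator
        (fun _ => (2⁻¹ : ℝ≥0∞) ^ i * (C i + 1 : ℝ≥0∞)⁻¹) g ∂(fiberMeasure L) ≤ 2 := by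
      refine le_trans ?_ ENNReal.tsum_geometric_two.le
      refine ENNReal.tsum_le_tsum fun i => ?_
      rw [lintegral_indicator_const (hmeas i), mul_assoc]
      refine mul_le_of_le_one_right zero_le ?_
      rw [mul_comm, ← div_eq_mul_inv]
      refine ENNReal.div_le_of_le_mul ?_
      rw [one_mul]
      exact (hC i L).trans le_self_add
    exact ne_top_of_le_ne_top (by simp) this

theorem liftMeasure_boundedSLR_lt_top {n : ℕ} (μ : Measure (LatticeSpace n))
    [IsProbabilityMeasure μ] (i : ℕ) : liftMeasure μ (boundedSLR n i) < ∞ := by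
  obtain ⟨C, hC⟩ := exists_fiberMeasure_boundedSLR_le n i
  have hmeas : MeasurableSet (boundedSLR n i) := (isClosed_boundedSLR n i).measurableSet
  rw [liftMeasure, Measure.bind_apply hmeas (measurable_fiberMeasure n).aemeasurable]
  calc ∫⁻ L, fiberMeasure L (boundedSLR n i) ∂μ ≤ ∫⁻ _, C ∂μ := lintegral_mono hC
    _ < ∞ := by simp

theorem sigmaFinite_liftMeasure {n : ℕ} (μ : Measure (LatticeSpace n))
    [IsProbabilityMeasure μ] : SigmaFinite (liftMeasure μ) := by
  refine ⟨⟨⟨boundedSLR n, fun _ => trivial, liftMeasure_boundedSLR_lt_top μ, ?_⟩⟩⟩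
  exact Set.eq_univ_of_forall fun g => Set.mem_iUnion.2 (exists_mem_boundedSLR g)

/-- Two invariant probability measures on the space of lattices coincide. -/
theorem invariant_probability_unique {n : ℕ} {μ ν : Measure (LatticeSpace n)}
    [IsProbabilityMeasure μ] [IsProbabilityMeasure ν]
    (hμ : ∀ g : SLR n, Measure.map (fun x => g • x) μ = μ)
    (hν : ∀ g : SLR n, Measure.map (fun x => g • x) ν = ν) : μ = ν := by
  obtain ⟨u, hu, hu'⟩ := exists_fiber_weight n
  have := isMulLeftInvariant_liftMeasure hμ
  have := isMulLeftInvariant_liftMeasure hν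
  have := sigmaFinite_liftMeasure μ
  have := sigmaFinite_liftMeasure ν
  have hU : Measurable fun L : LatticeSpace n => ∫⁻ g, u g ∂(fiberMeasure L) :=
    (Measure.measurable_lintegral hu).comp (measurable_fiberMeasure n)
  have key : ∀ (μ : Measure (LatticeSpace n)) {φ : LatticeSpace n → ℝ≥0∞}, Measurable φ →
      ∫⁻ L, φ L ∂μ = ∫⁻ h, (φ (toLattice h) / ∫⁻ g, u g ∂(fiberMeasure (toLattice h))) * u h
        ∂(liftMeasure μ) := fun μ φ hφ => by
    rw [lintegral_lintegral_fiberMeasure μ hu (φ := fun L => φ L / ∫⁻ g, u g ∂(fiberMeasure L))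
      (hφ.div hU)]
    exact lintegral_congr fun L => (ENNReal.div_mul_cancel (hu' L).1 (hu' L).2).symm
  obtain ⟨i, hi⟩ : ∃ i, liftMeasure ν (boundedSLR n i) ≠ 0 := by
    by_contra! h
    have h0 : liftMeasure ν = 0 := by
      rw [← Measure.measure_univ_eq_zero, ← Set.eq_univ_of_forall
        fun g => Set.mem_iUnion.2 (exists_mem_boundedSLR g), measure_iUnion_null_iff]
      exact h
    have h1 := key ν (φ := 1) measurable_one
    rw [h0] at h1
    simp at h1
  have hc := measure_eq_div_smul (liftMeasure μ) (liftMeasure ν) hi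
    (liftMeasure_boundedSLR_lt_top ν i).ne
  set c := liftMeasure μ (boundedSLR n i) / liftMeasure ν (boundedSLR n i)
  have hall : ∀ {φ : LatticeSpace n → ℝ≥0∞}, Measurable φ →
      ∫⁻ L, φ L ∂μ = c * ∫⁻ L, φ L ∂ν := fun {φ} hφ => by
    rw [key μ hφ, key ν hφ, hc, lintegral_smul_measure, smul_eq_mul]
  have hc1 : c = 1 := by
    have := hall (φ := 1) measurable_one
    simpa using this.symm
  refine Measure.ext_of_lintegral _ fun φ hφ => ?_
  rw [hall hφ, hc1, one_mul]

theorem sum_out_toLattice {n : ℕ} {ι : Type*} [Fintype ι] {h : ι → LatticeSpace n}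
    (hperm : ∀ γ : SLZ n, ∃ σ : ι ≃ ι, ∀ i, (γ : SLR n) • h i = h (σ i))
    (φ : LatticeSpace n → ℝ≥0∞) (g : SLR n) :
    ∑ i, φ (Quotient.out (α := SLR n) (toLattice g) • h i) = ∑ i, φ (g • h i) := by
  obtain ⟨γ, hγ⟩ := exists_out_toLattice g
  obtain ⟨σ, hσ⟩ := hperm γ
  rw [hγ]
  simp_rw [mul_smul, hσ]
  exact σ.sum_comp fun i => φ (g • h i)

theorem measurable_smul_lattice {n : ℕ} (L : LatticeSpace n) :
    Measurable fun g : SLR n => g • L := by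
  obtain ⟨k, rfl⟩ := surjective_toLattice n L
  simp_rw [smul_toLattice]
  exact (measurable_toLattice n).comp (measurable_mul_const k)

theorem measurable_sum_out_smul {n : ℕ} {ι : Type*} [Fintype ι] {h : ι → LatticeSpace n}
    (hperm : ∀ γ : SLZ n, ∃ σ : ι ≃ ι, ∀ i, (γ : SLR n) • h i = h (σ i))
    {φ : LatticeSpace n → ℝ≥0∞} (hφ : Measurable φ) :
    Measurable fun L : LatticeSpace n => ∑ i, φ (Quotient.out (α := SLR n) L • h i) := by
  refine measurable_of_comp_toLattice ?_
  simp_rw [sum_out_toLattice hperm φ]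
  exact Finset.measurable_sum _ fun i _ => hφ.comp (measurable_smul_lattice _)

theorem lintegral_eq_lintegral_average {n : ℕ} {ι : Type*} [Fintype ι] [Nonempty ι]
    {h : ι → LatticeSpace n} (hperm : ∀ γ : SLZ n, ∃ σ : ι ≃ ι, ∀ i, (γ : SLR n) • h i = h (σ i))
    {μ : Measure (LatticeSpace n)} [IsProbabilityMeasure μ]
    (hinv : ∀ g : SLR n, Measure.map (fun x => g • x) μ = μ)
    {φ : LatticeSpace n → ℝ≥0∞} (hφ : Measurable φ) :
    ∫⁻ L, φ L ∂μ =
      ∫⁻ L, (Fintype.card ι : ℝ≥0∞)⁻¹ * ∑ i, φ (Quotient.out (α := SLR n) L • h i) ∂μ := by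
  have hout := sum_out_toLattice hperm
  set κ : LatticeSpace n → Measure (LatticeSpace n) := fun L =>
    (Fintype.card ι : ℝ≥0∞)⁻¹ • ∑ i, Measure.dirac (Quotient.out (α := SLR n) L • h i) with hκ
  have hκint : ∀ {φ : LatticeSpace n → ℝ≥0∞}, Measurable φ → ∀ L, ∫⁻ x, φ x ∂(κ L) =
      (Fintype.card ι : ℝ≥0∞)⁻¹ * ∑ i, φ (Quotient.out (α := SLR n) L • h i) := by
    intro φ hφ L
    rw [hκ, lintegral_smul_measure, smul_eq_mul, lintegral_finsetSum_measure]
    simp_rw [lintegral_dirac' _ hφ]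
  have hκmeas : Measurable κ := by
    refine Measure.measurable_of_measurable_coe _ fun A hA => measurable_of_comp_toLattice ?_
    have h1 : Measurable (A.indicator (1 : LatticeSpace n → ℝ≥0∞)) := measurable_one.indicator hA
    simp_rw [← lintegral_indicator_one hA]
    simp_rw [hκint h1, hout]
    exact (Finset.measurable_sum _ fun i _ => h1.comp (measurable_smul_lattice _)).const_mul _
  have hbind : ∀ {φ : LatticeSpace n → ℝ≥0∞}, Measurable φ → ∫⁻ L, φ L ∂(μ.bind κ) =
      ∫⁻ L, (Fintype.card ι : ℝ≥0∞)⁻¹ * ∑ i, φ (Quotient.out (α := SLR n) L • h i) ∂μ := by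
    intro φ hφ
    rw [Measure.lintegral_bind hκmeas.aemeasurable hφ.aemeasurable]
    exact lintegral_congr (hκint hφ)
  have hprob : IsProbabilityMeasure (μ.bind κ) := by
    refine ⟨?_⟩
    rw [← lintegral_one, hbind measurable_const]
    simp [ENNReal.inv_mul_cancel]
  have hinv' : ∀ g : SLR n, Measure.map (fun x => g • x) (μ.bind κ) = μ.bind κ := by
    intro g
    refine Measure.ext_of_lintegral _ fun φ hφ => ?_
    have hg := (continuous_smul_lattice g).measurable
    have hκφ : Measurable fun L => ∫⁻ x, φ x ∂(κ L) :=
      (Measure.measurable_lintegral hφ).comp hκmeas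
    rw [lintegral_map hφ hg, hbind (φ := fun x => φ (g • x)) (hφ.comp hg), hbind hφ]
    simp_rw [hκint hφ] at hκφ
    rw [← lintegral_smul_lattice hinv g hκφ]
    refine lintegral_congr fun L => ?_
    obtain ⟨k, rfl⟩ := surjective_toLattice n L
    rw [smul_toLattice, hout, hout fun x => φ (g • x)]
    simp_rw [mul_smul]
  rw [← hbind hφ, ← invariant_probability_unique hinv hinv']

theorem mem_latticeOf_toLattice {n : ℕ} {g : SLR n} {y : Fin n → ℝ} :
    y ∈ latticeOf (toLattice g) ↔ ∃ v : Fin n → ℤ, y = g.1.mulVec (fun i => (v i : ℝ)) := by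
  obtain ⟨⟨γ, a, ha⟩, hγ⟩ := exists_out_toLattice g
  have hcast : ∀ (b : Matrix.SpecialLinearGroup (Fin n) ℤ) (v : Fin n → ℤ),
      (Matrix.SpecialLinearGroup.map (Int.castRingHom ℝ) b).1.mulVec (fun i => (v i : ℝ)) =
        fun i => ((b.1.mulVec v i : ℤ) : ℝ) := fun b v => by
    ext i
    simp [Matrix.mulVec, dotProduct]
  unfold latticeOf
  simp only [Set.mem_ofPred_eq, hγ, Matrix.SpecialLinearGroup.coe_mul, ← Matrix.mulVec_mulVec]
  constructor
  · rintro ⟨v, rfl⟩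
    exact ⟨a.1.mulVec v, by rw [← hcast, ha]⟩
  · rintro ⟨v, rfl⟩
    refine ⟨(a⁻¹).1.mulVec v, ?_⟩
    rw [← hcast, ← ha, Matrix.mulVec_mulVec _ (Matrix.SpecialLinearGroup.map _ a).1,
      ← Matrix.SpecialLinearGroup.coe_mul, ← map_mul]
    simp

theorem mem_latticeOf_smul {n : ℕ} {g : SLR n} {L : LatticeSpace n} {y : Fin n → ℝ} :
    y ∈ latticeOf (g • L) ↔ ∃ x ∈ latticeOf L, y = g.1.mulVec x := by
  obtain ⟨k, rfl⟩ := surjective_toLattice n L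
  simp [smul_toLattice, mem_latticeOf_toLattice, ← Matrix.mulVec_mulVec]

theorem injective_latticeOf (n : ℕ) : Function.Injective (latticeOf (n := n)) := by
  intro L L' hLL
  obtain ⟨g, rfl⟩ := surjective_toLattice n L
  obtain ⟨k, rfl⟩ := surjective_toLattice n L'
  rw [toLattice_eq_iff, mem_SLZ_iff]
  intro i j
  have : k.1.mulVec (fun i => ((Pi.single j 1 : Fin n → ℤ) i : ℝ)) ∈ latticeOf (toLattice k) :=
    mem_latticeOf_toLattice.2 ⟨_, rfl⟩
  rw [← hLL, mem_latticeOf_toLattice] at this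
  obtain ⟨v, hv⟩ := this
  refine ⟨v i, ?_⟩
  have h1 := congrArg (fun x => (g⁻¹).1.mulVec x i) hv
  have h2 : (fun i => ((Pi.single j 1 : Fin n → ℤ) i : ℝ)) = Pi.single j 1 := by
    ext a
    by_cases h : a = j
    · subst h; simp
    · simp [h]
  simp only [h2, Matrix.mulVec_mulVec, ← Matrix.SpecialLinearGroup.coe_mul, inv_mul_cancel] at h1
  simpa using h1

/-- The vectors of `ℤⁿ` annihilated by a linear form modulo `p`, rescaled by `t⁻¹`. -/
def congruenceLattice {n p : ℕ} (t : ℝ) (φ : Fin n → ZMod p) : Set (Fin n → ℝ) :=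
  {y | ∃ w : Fin n → ℤ, φ ⬝ᵥ (fun i => (w i : ZMod p)) = 0 ∧ y = t⁻¹ • fun i => (w i : ℝ)}

theorem exists_latticeOf_eq_congruenceLattice {n p : ℕ} [Fact p.Prime] {t : ℝ} (ht : t ^ n = p)
    {φ : Fin n → ZMod p} (hφ : φ ≠ 0) :
    ∃ L : LatticeSpace n, latticeOf L = congruenceLattice t φ := by
  obtain ⟨i, hi⟩ := Function.ne_iff.1 hφ
  simp only [Pi.zero_apply] at hi
  have hp : (p : ℝ) ≠ 0 := by exact_mod_cast (Fact.out : p.Prime).ne_zero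
  set r : Fin n → ℤ := fun j => if j = i then (p : ℤ) else ((-φ j / φ i).val : ℤ) with hr
  have hri : r i = p := by simp [hr]
  set A : Matrix (Fin n) (Fin n) ℤ := Matrix.updateRow 1 i r with hA
  have hdet : A.det = p := by
    rw [hA, ← Matrix.cramer_transpose_apply]
    simp [hri]
  have hdet' : (t⁻¹ • A.map (Int.castRingHom ℝ)).det = 1 := by
    rw [Matrix.det_smul, ← RingHom.mapMatrix_apply, ← RingHom.map_det, hdet]
    simp [ht, hp]
  have hφr : ∀ w : Fin n → ℤ, φ ⬝ᵥ (fun j => (w j : ZMod p)) =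
      φ i * ((w i : ZMod p) - ((r ⬝ᵥ w : ℤ) : ZMod p)) := by
    intro w
    have h1 : ∀ j, φ j * (w j : ZMod p) =
        (if j = i then φ i * w i else 0) - φ i * ((r j * w j : ℤ) : ZMod p) := by
      intro j
      by_cases hj : j = i
      · subst hj; simp [hri]
      · simp only [hr, hj, if_false]
        push_cast
        rw [ZMod.natCast_zmod_val]
        field_simp
        ring
    rw [dotProduct, Finset.sum_congr rfl fun j _ => h1 j, Finset.sum_sub_distrib,
      Finset.sum_ite_eq' Finset.univ i, if_pos (Finset.mem_univ i), ← Finset.mul_sum, dotProduct,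
      Int.cast_sum]
    ring
  have hAi : ∀ v : Fin n → ℤ, A.mulVec v i = r ⬝ᵥ v := fun v => by
    change Matrix.updateRow 1 i r i ⬝ᵥ v = r ⬝ᵥ v
    rw [Matrix.updateRow_self]
  have hAj : ∀ (v : Fin n → ℤ) j, j ≠ i → A.mulVec v j = v j := fun v j hj => by
    change Matrix.updateRow 1 i r j ⬝ᵥ v = v j
    rw [Matrix.updateRow_ne hj]
    exact congrFun (Matrix.one_mulVec v) j
  have hcast : ∀ v : Fin n → ℤ, (t⁻¹ • A.map (Int.castRingHom ℝ)).mulVec (fun i => (v i : ℝ)) =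
      t⁻¹ • fun i => ((A.mulVec v i : ℤ) : ℝ) := fun v => by
    ext j
    simp [Matrix.mulVec, dotProduct, Finset.mul_sum, mul_assoc]
  have hsplit : ∀ w : Fin n → ℤ, r ⬝ᵥ w = p * w i + ∑ j ∈ Finset.univ.erase i, r j * w j := by
    intro w
    rw [dotProduct, ← Finset.add_sum_erase _ _ (Finset.mem_univ i), hri]
  obtain ⟨g, hg⟩ : ∃ g : SLR n, g.1 = t⁻¹ • A.map (Int.castRingHom ℝ) := ⟨⟨_, hdet'⟩, rfl⟩
  refine ⟨toLattice g, ?_⟩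
  ext y
  rw [mem_latticeOf_toLattice, hg]
  constructor
  · rintro ⟨v, rfl⟩
    refine ⟨A.mulVec v, ?_, hcast v⟩
    rw [hφr, hAi, hsplit (A.mulVec v), hsplit v]
    rw [Finset.sum_congr rfl fun j hj =>
      congrArg (r j * ·) (hAj v j (Finset.ne_of_mem_erase hj))]
    simp
  · rintro ⟨w, hw, rfl⟩
    rw [hφr, mul_eq_zero, or_iff_right hi, ← Int.cast_sub, ZMod.intCast_zmod_eq_zero_iff_dvd] at hw
    obtain ⟨k, hk⟩ := hw
    refine ⟨Function.update w i (k + w i), ?_⟩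
    rw [hcast]
    congr 1
    ext j
    congr 1
    by_cases hj : j = i
    · subst hj
      rw [hAi, hsplit]
      rw [Finset.sum_congr rfl fun l hl =>
        congrArg (r l * ·) (Function.update_of_ne (Finset.ne_of_mem_erase hl) _ _)]
      rw [hsplit] at hk
      simp only [Function.update_self]
      linarith
    · rw [hAj _ _ hj, Function.update_of_ne hj]

theorem exists_perm_congruenceLattice {n p : ℕ} {t : ℝ}
    {h : {φ : Fin n → ZMod p // φ ≠ 0} → LatticeSpace n}
    (hh : ∀ φ, latticeOf (h φ) = congruenceLattice t φ.1) (γ : SLZ n) :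
    ∃ σ : {φ : Fin n → ZMod p // φ ≠ 0} ≃ {φ : Fin n → ZMod p // φ ≠ 0},
      ∀ φ, (γ : SLR n) • h φ = h (σ φ) := by
  obtain ⟨_, a, rfl⟩ := γ
  have hcast : ∀ (b : Matrix.SpecialLinearGroup (Fin n) ℤ) (v : Fin n → ℤ),
      (Matrix.SpecialLinearGroup.map (Int.castRingHom ℝ) b).1.mulVec (fun i => (v i : ℝ)) =
        fun i => ((b.1.mulVec v i : ℤ) : ℝ) := fun b v => by
    ext i
    simp [Matrix.mulVec, dotProduct]
  have hcastp : ∀ (b : Matrix.SpecialLinearGroup (Fin n) ℤ) (v : Fin n → ℤ),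
      (b.1.map (Int.castRingHom (ZMod p))).mulVec (fun i => (v i : ZMod p)) =
        fun i => ((b.1.mulVec v i : ℤ) : ZMod p) := fun b v => by
    ext i
    simp [Matrix.mulVec, dotProduct]
  have hmul : ∀ b c : Matrix.SpecialLinearGroup (Fin n) ℤ, b * c = 1 →
      b.1.map (Int.castRingHom (ZMod p)) * c.1.map (Int.castRingHom (ZMod p)) = 1 := by
    intro b c hbc
    rw [← Matrix.map_mul, ← Matrix.SpecialLinearGroup.coe_mul, hbc]
    simp
  set P : Matrix (Fin n) (Fin n) (ZMod p) := a.1.map (Int.castRingHom (ZMod p))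
  set Q : Matrix (Fin n) (Fin n) (ZMod p) := (a⁻¹).1.map (Int.castRingHom (ZMod p))
  have hPQ : P * Q = 1 := hmul _ _ (mul_inv_cancel a)
  have hQP : Q * P = 1 := hmul _ _ (inv_mul_cancel a)
  let e : (Fin n → ZMod p) ≃ (Fin n → ZMod p) :=
    { toFun := fun φ => Matrix.vecMul φ Q
      invFun := fun φ => Matrix.vecMul φ P
      left_inv := fun φ => by simp [Matrix.vecMul_vecMul, hQP]
      right_inv := fun φ => by simp [Matrix.vecMul_vecMul, hPQ] }
  refine ⟨e.subtypeEquiv fun φ => ?_, fun φ => injective_latticeOf n ?_⟩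
  · have h0 : e 0 = 0 := Matrix.zero_vecMul Q
    rw [ne_eq, ne_eq, ← e.injective.eq_iff (a := φ) (b := 0), h0]
  · rw [hh]
    ext y
    rw [mem_latticeOf_smul, hh]
    change _ ↔ ∃ w : Fin n → ℤ, Matrix.vecMul φ.1 Q ⬝ᵥ _ = 0 ∧ _
    simp_rw [← Matrix.dotProduct_mulVec]
    constructor
    · rintro ⟨_, ⟨w, hw, rfl⟩, rfl⟩
      refine ⟨a.1.mulVec w, ?_, ?_⟩
      · rw [hcastp, Matrix.mulVec_mulVec, ← Matrix.SpecialLinearGroup.coe_mul]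
        simpa using hw
      · rw [Matrix.mulVec_smul, hcast]
    · rintro ⟨w, hw, rfl⟩
      rw [hcastp] at hw
      refine ⟨_, ⟨_, hw, rfl⟩, ?_⟩
      rw [Matrix.mulVec_smul, hcast, Matrix.mulVec_mulVec, ← Matrix.SpecialLinearGroup.coe_mul]
      simp

/-- The real tuple underlying a tuple of integer vectors. -/
def realTuple {n ℓ : ℕ} (M : Fin ℓ → Fin n → ℤ) : Fin ℓ → Fin n → ℝ := fun k i => (M k i : ℝ)

/-- The action of a matrix on tuples of vectors. -/
def mulVecTuple {n ℓ : ℕ} (A : Matrix (Fin n) (Fin n) ℝ) (x : Fin ℓ → Fin n → ℝ) :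
    Fin ℓ → Fin n → ℝ := fun k => A.mulVec (x k)

theorem linearIndependent_mulVecTuple {n ℓ : ℕ} {A : Matrix (Fin n) (Fin n) ℝ} (hA : IsUnit A)
    {x : Fin ℓ → Fin n → ℝ} :
    LinearIndependent ℝ (mulVecTuple A x) ↔ LinearIndependent ℝ x := by
  have hker : LinearMap.ker A.mulVecLin = ⊥ :=
    LinearMap.ker_eq_bot.2 (Matrix.mulVec_injective_iff_isUnit.2 hA)
  exact LinearMap.linearIndependent_iff A.mulVecLin hker

theorem injective_mulVecTuple_realTuple {n ℓ : ℕ} {A : Matrix (Fin n) (Fin n) ℝ} (hA : IsUnit A) :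
    Function.Injective fun M : Fin ℓ → Fin n → ℤ => mulVecTuple A (realTuple M) := by
  intro M M' h
  funext k i
  have h1 := Matrix.mulVec_injective_iff_isUnit.2 hA (congrFun h k)
  have h2 := congrFun h1 i
  exact Int.cast_injective (α := ℝ) h2

/-- Linearly independent `ℓ`-tuples of vectors in a set. -/
def indepTuples {n : ℕ} (ℓ : ℕ) (S : Set (Fin n → ℝ)) : Set (Fin ℓ → Fin n → ℝ) :=
  {x | (∀ k, x k ∈ S) ∧ LinearIndependent ℝ x}

open scoped Classical in
theorem tsum_indepTuples_image {n ℓ : ℕ} {A : Matrix (Fin n) (Fin n) ℝ} (hA : IsUnit A)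
    (W : Set (Fin n → ℤ)) (F : (Fin ℓ → Fin n → ℝ) → ℝ≥0∞) :
    ∑' x : indepTuples ℓ {y | ∃ w ∈ W, y = A.mulVec fun i => (w i : ℝ)}, F x =
      ∑' M : Fin ℓ → Fin n → ℤ, if LinearIndependent ℝ (realTuple M) ∧ ∀ k, M k ∈ W then
        F (mulVecTuple A (realTuple M)) else 0 := by
  have himage : indepTuples ℓ {y | ∃ w ∈ W, y = A.mulVec fun i => (w i : ℝ)} =
      (fun M : Fin ℓ → Fin n → ℤ => mulVecTuple A (realTuple M)) ''
        {M | LinearIndependent ℝ (realTuple M) ∧ ∀ k, M k ∈ W} := by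
    ext x
    constructor
    · rintro ⟨hx, hli⟩
      choose M hMW hM using hx
      have : x = mulVecTuple A (realTuple M) := funext hM
      exact ⟨M, ⟨by rwa [this, linearIndependent_mulVecTuple hA] at hli, hMW⟩, this.symm⟩
    · rintro ⟨M, ⟨hli, hMW⟩, rfl⟩
      exact ⟨fun k => ⟨M k, hMW k, rfl⟩, (linearIndependent_mulVecTuple hA).2 hli⟩
  rw [himage, tsum_image F (injective_mulVecTuple_realTuple hA).injOn,
    tsum_subtype _ fun M => F (mulVecTuple A (realTuple M))]
  simp only [Set.indicator_apply, Set.mem_ofPred_eq]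

theorem isUnit_SLR {n : ℕ} (g : SLR n) : IsUnit g.1 := by
  rw [Matrix.isUnit_iff_isUnit_det, g.2]; exact isUnit_one

/-- The counting measure on the linearly independent `ℓ`-tuples of vectors of a lattice. -/
def tupleMeasure {n : ℕ} (ℓ : ℕ) (L : LatticeSpace n) : Measure (Fin ℓ → Fin n → ℝ) :=
  Measure.sum fun x : indepTuples ℓ (latticeOf L) => Measure.dirac x.1

theorem lintegral_tupleMeasure {n ℓ : ℕ} (L : LatticeSpace n) {F : (Fin ℓ → Fin n → ℝ) → ℝ≥0∞}
    (hF : Measurable F) :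
    ∫⁻ x, F x ∂(tupleMeasure ℓ L) = ∑' x : indepTuples ℓ (latticeOf L), F x := by
  rw [tupleMeasure, lintegral_sum_measure]
  simp_rw [lintegral_dirac' _ hF]

open scoped Classical in
theorem lintegral_tupleMeasure_toLattice {n ℓ : ℕ} (g : SLR n)
    {F : (Fin ℓ → Fin n → ℝ) → ℝ≥0∞} (hF : Measurable F) :
    ∫⁻ x, F x ∂(tupleMeasure ℓ (toLattice g)) =
      ∑' M : Fin ℓ → Fin n → ℤ, if LinearIndependent ℝ (realTuple M) then
        F (mulVecTuple g.1 (realTuple M)) else 0 := by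
  have h : latticeOf (toLattice g) =
      {y | ∃ w ∈ (Set.univ : Set (Fin n → ℤ)), y = g.1.mulVec fun i => (w i : ℝ)} := by
    ext y; simp [mem_latticeOf_toLattice]
  rw [lintegral_tupleMeasure _ hF, h, tsum_indepTuples_image (isUnit_SLR g)]
  simp

theorem continuous_mulVecTuple_SLR {n ℓ : ℕ} (x : Fin ℓ → Fin n → ℝ) :
    Continuous fun g : SLR n => mulVecTuple g.1 x :=
  continuous_pi fun _ => (continuous_coe_SLR n).matrix_mulVec continuous_const

theorem measurable_tupleMeasure (n ℓ : ℕ) : Measurable (tupleMeasure (n := n) ℓ) := by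
  classical
  refine Measure.measurable_of_measurable_coe _ fun A hA => measurable_of_comp_toLattice ?_
  have h1 : Measurable (A.indicator (1 : (Fin ℓ → Fin n → ℝ) → ℝ≥0∞)) := measurable_one.indicator hA
  simp_rw [← lintegral_indicator_one hA, lintegral_tupleMeasure_toLattice _ h1]
  refine Measurable.tsum fun M => ?_
  split_ifs
  · exact h1.comp (continuous_mulVecTuple_SLR _).measurable
  · exact measurable_const

/-- The nonzero linear forms modulo `p` annihilating a tuple of integer vectors. -/
def annihilators {n ℓ : ℕ} (p : ℕ) (M : Fin ℓ → Fin n → ℤ) : Set (Fin n → ZMod p) :=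
  {φ | φ ≠ 0 ∧ ∀ k, φ ⬝ᵥ (fun i => (M k i : ZMod p)) = 0}

open scoped Classical in
theorem sum_tupleMeasure_hecke {n ℓ p : ℕ} [Fact p.Prime] {t : ℝ} (ht : t ≠ 0)
    {h : {φ : Fin n → ZMod p // φ ≠ 0} → LatticeSpace n}
    (hh : ∀ φ, latticeOf (h φ) = congruenceLattice t φ.1) (g : SLR n)
    {A : Set (Fin ℓ → Fin n → ℝ)} (hA : MeasurableSet A) :
    ∑ φ, tupleMeasure ℓ (g • h φ) A = ∑' M : Fin ℓ → Fin n → ℤ,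
      if LinearIndependent ℝ (realTuple M) ∧ mulVecTuple (t⁻¹ • g.1) (realTuple M) ∈ A then
        ((annihilators p M).ncard : ℝ≥0∞) else 0 := by
  have h1 : Measurable (A.indicator (1 : (Fin ℓ → Fin n → ℝ) → ℝ≥0∞)) := measurable_one.indicator hA
  have hunit : IsUnit (t⁻¹ • g.1) := by
    rw [Matrix.isUnit_iff_isUnit_det, Matrix.det_smul, g.2, mul_one]
    exact (isUnit_iff_ne_zero.2 (inv_ne_zero ht)).pow _
  have hset : ∀ φ, latticeOf (g • h φ) =
      {y | ∃ w ∈ {w : Fin n → ℤ | φ.1 ⬝ᵥ (fun i => (w i : ZMod p)) = 0},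
        y = (t⁻¹ • g.1).mulVec fun i => (w i : ℝ)} := by
    intro φ
    ext y
    rw [mem_latticeOf_smul, hh]
    constructor
    · rintro ⟨_, ⟨w, hw, rfl⟩, rfl⟩
      exact ⟨w, hw, by rw [Matrix.mulVec_smul, Matrix.smul_mulVec]⟩
    · rintro ⟨w, hw, rfl⟩
      exact ⟨_, ⟨w, hw, rfl⟩, by rw [Matrix.mulVec_smul, Matrix.smul_mulVec]⟩
  have hφ : ∀ φ, tupleMeasure ℓ (g • h φ) A = ∑' M : Fin ℓ → Fin n → ℤ,
      if LinearIndependent ℝ (realTuple M) ∧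
        ∀ k, M k ∈ {w : Fin n → ℤ | φ.1 ⬝ᵥ (fun i => (w i : ZMod p)) = 0} then
      A.indicator (1 : (Fin ℓ → Fin n → ℝ) → ℝ≥0∞) (mulVecTuple (t⁻¹ • g.1) (realTuple M))
      else 0 := fun φ => by
    rw [← lintegral_indicator_one hA, lintegral_tupleMeasure _ h1, hset,
      tsum_indepTuples_image hunit]
    congr!
  rw [Finset.sum_congr rfl fun φ _ => hφ φ]
  rw [← Summable.tsum_finsetSum fun _ _ => ENNReal.summable]
  refine tsum_congr fun M => ?_
  by_cases hM : LinearIndependent ℝ (realTuple M) ∧ mulVecTuple (t⁻¹ • g.1) (realTuple M) ∈ A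
  · rw [if_pos hM]
    simp only [hM.1, true_and, Set.indicator_of_mem hM.2, Pi.one_apply, Set.mem_ofPred_eq]
    rw [Finset.sum_boole]
    have : annihilators p M = ((↑) : {φ : Fin n → ZMod p // φ ≠ 0} → _) ''
        ((Finset.univ.filter fun φ : {φ : Fin n → ZMod p // φ ≠ 0} =>
          ∀ k, φ.1 ⬝ᵥ (fun i => (M k i : ZMod p)) = 0 : Finset _) : Set _) := by
      ext φ
      simp [annihilators, and_comm]
    rw [this, Set.ncard_image_of_injective _ Subtype.val_injective, Set.ncard_coe_finset]
  · rw [if_neg hM]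
    refine Finset.sum_eq_zero fun φ _ => ?_
    split_ifs with h2
    · exact Set.indicator_of_notMem (fun h3 => hM ⟨h2.1, h3⟩) _
    · rfl

theorem ncard_annihilators_add_one {n ℓ p : ℕ} [Fact p.Prime] (M : Fin ℓ → Fin n → ℤ) :
    (annihilators p M).ncard + 1 =
      p ^ (n - (Matrix.of fun k i => (M k i : ZMod p)).rank) := by
  set P : Matrix (Fin ℓ) (Fin n) (ZMod p) := Matrix.of fun k i => (M k i : ZMod p) with hP
  have hmem : ∀ φ, φ ∈ LinearMap.ker P.mulVecLin ↔
      ∀ k, φ ⬝ᵥ (fun i => (M k i : ZMod p)) = 0 := by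
    intro φ
    rw [LinearMap.mem_ker, funext_iff]
    refine forall_congr' fun k => ?_
    simp [Matrix.mulVec, hP, dotProduct_comm]
  have hset : (LinearMap.ker P.mulVecLin : Set (Fin n → ZMod p)) =
      insert 0 (annihilators p M) := by
    ext φ
    simp only [SetLike.mem_coe, hmem, annihilators, Set.mem_insert_iff, Set.mem_ofPred_eq]
    by_cases h : φ = 0
    · simp [h]
    · simp [h]
  have h0 : (0 : Fin n → ZMod p) ∉ annihilators p M := fun h => h.1 rfl
  rw [← Set.ncard_insert_of_notMem h0 (Set.toFinite _), ← hset]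
  have hcard : Nat.card (LinearMap.ker P.mulVecLin) =
      Nat.card (ZMod p) ^ Module.finrank (ZMod p) (LinearMap.ker P.mulVecLin) :=
    Module.natCard_eq_pow_finrank
  have hrank := LinearMap.finrank_range_add_finrank_ker P.mulVecLin
  rw [Module.finrank_fin_fun] at hrank
  change Nat.card (LinearMap.ker P.mulVecLin) = _
  rw [hcard, Nat.card_zmod]
  congr 1
  rw [Matrix.rank]
  omega

theorem pow_le_ncard_annihilators {n ℓ p : ℕ} [Fact p.Prime] (M : Fin ℓ → Fin n → ℤ) :
    p ^ (n - ℓ) ≤ (annihilators p M).ncard + 1 := by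
  rw [ncard_annihilators_add_one]
  refine Nat.pow_le_pow_right (Fact.out : p.Prime).pos ?_
  have := (Matrix.of fun k i => (M k i : ZMod p)).rank_le_height
  omega

theorem exists_submatrix_det_ne_zero {n ℓ : ℕ} {A : Matrix (Fin ℓ) (Fin n) ℝ}
    (hA : LinearIndependent ℝ A.row) : ∃ a : Fin ℓ → Fin n, (A.submatrix id a).det ≠ 0 := by
  obtain ⟨κ, a, ha, hspan, hli⟩ := exists_linearIndependent' ℝ A.col
  have : Finite κ := Finite.of_injective a ha
  have := Fintype.ofFinite κ
  have hcard : Fintype.card κ = ℓ := by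
    rw [linearIndependent_iff_card_eq_finrank_span.1 hli, Set.finrank, hspan,
      ← Matrix.rank_eq_finrank_span_cols, hA.rank_matrix, Fintype.card_fin]
  let e := (Fintype.equivFinOfCardEq hcard).symm
  refine ⟨a ∘ e, isUnit_iff_ne_zero.1 ?_⟩
  rw [← Matrix.isUnit_iff_isUnit_det, ← Matrix.linearIndependent_cols_iff_isUnit]
  exact hli.comp e e.injective

theorem ncard_annihilators_of_bound {n ℓ p : ℕ} [Fact p.Prime] {M : Fin ℓ → Fin n → ℤ}
    (hM : LinearIndependent ℝ (realTuple M)) {b : ℤ} (hb : ∀ k i, |M k i| ≤ b)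
    (hbp : (ℓ.factorial : ℤ) * b ^ ℓ < p) :
    (annihilators p M).ncard + 1 = p ^ (n - ℓ) := by
  rw [ncard_annihilators_add_one]
  congr 2
  refine le_antisymm (Matrix.rank_le_height _) ?_
  obtain ⟨a, ha⟩ := exists_submatrix_det_ne_zero (A := (Matrix.of M).map (Int.castRingHom ℝ)) hM
  set G := (Matrix.of M).submatrix id a with hG
  have hdet : |G.det| ≤ (ℓ.factorial : ℤ) * b ^ ℓ := by
    have := Matrix.det_le (A := G) (abv := AbsoluteValue.abs) (x := b) fun i j => hb i (a j)
    simpa [AbsoluteValue.abs] using this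
  have hdet0 : G.det ≠ 0 := by
    intro h0
    rw [Matrix.submatrix_map, ← RingHom.mapMatrix_apply, ← RingHom.map_det, h0, map_zero] at ha
    exact ha rfl
  have hunit : IsUnit (G.map (Int.castRingHom (ZMod p))) := by
    rw [Matrix.isUnit_iff_isUnit_det, ← RingHom.mapMatrix_apply, ← RingHom.map_det, eq_intCast]
    refine isUnit_iff_ne_zero.2 fun h0 => hdet0 ?_
    rw [ZMod.intCast_zmod_eq_zero_iff_dvd] at h0
    exact Int.eq_zero_of_abs_lt_dvd h0 (hdet.trans_lt hbp)
  have hrank := Matrix.rank_of_isUnit _ hunit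
  rw [hG, ← Matrix.submatrix_map, Fintype.card_fin] at hrank
  exact hrank.ge.trans (Matrix.rank_submatrix_le _ _ _)

section

open Filter Topology

theorem measurableSet_linearIndependent (n ℓ : ℕ) :
    MeasurableSet {x : Fin ℓ → Fin n → ℝ | LinearIndependent ℝ x} :=
  isOpen_setOfPred_linearIndependent.measurableSet

theorem ae_linearIndependent {n ℓ : ℕ} (hℓ : ℓ ≤ n) :
    ∀ᵐ x : Fin ℓ → Fin n → ℝ, LinearIndependent ℝ x := by
  induction ℓ with
  | zero => exact Eventually.of_forall fun x => linearIndependent_empty_type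
  | succ ℓ ih =>
    have hvp := (volume_preserving_piFinSuccAbove (fun _ : Fin (ℓ + 1) => Fin n → ℝ) 0)
    have hvp' : MeasurePreserving (fun x : Fin (ℓ + 1) → Fin n → ℝ =>
        ((fun k : Fin ℓ => x k.succ), x 0))
        volume volume := (Measure.measurePreserving_swap).comp hvp
    set s : Set ((Fin ℓ → Fin n → ℝ) × (Fin n → ℝ)) :=
      {q | LinearIndependent ℝ (Fin.cons q.2 q.1 : Fin (ℓ + 1) → Fin n → ℝ)} with hs
    have hcont : Continuous fun q : (Fin ℓ → Fin n → ℝ) × (Fin n → ℝ) =>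
        (Fin.cons q.2 q.1 : Fin (ℓ + 1) → Fin n → ℝ) :=
      Continuous.finCons continuous_snd continuous_fst
    have hsm : MeasurableSet sᶜ :=
      ((isOpen_setOfPred_linearIndependent (𝕜 := ℝ)).preimage hcont).measurableSet.compl
    have hnull : volume sᶜ = 0 := by
      rw [Measure.volume_eq_prod, Measure.measure_prod_null hsm]
      filter_upwards [ih (by omega)] with w hw
      have hW : Submodule.span ℝ (Set.range w) ≠ ⊤ := by
        intro h
        have h1 := finrank_range_le_card (R := ℝ) w
        rw [Set.finrank, h, finrank_top] at h1
        simp at h1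
        omega
      refine measure_mono_null ?_ (Measure.addHaar_submodule volume _ hW)
      intro v hv
      by_contra hv'
      exact hv (linearIndependent_finCons.2 ⟨hw, hv'⟩)
    have := hvp'.measure_preimage hsm.nullMeasurableSet
    rw [hnull] at this
    refine measure_mono_null ?_ this
    intro x hx
    simp only [Set.mem_preimage, Set.mem_compl_iff, hs]
    intro h
    refine hx ?_
    have h2 : (Fin.cons (x 0) (fun k => x k.succ) : Fin (ℓ + 1) → Fin n → ℝ) = x :=
      Fin.cons_self_tail x
    simp only [Set.mem_ofPred_eq, h2] at h
    exact h

/-- The coordinatewise integer part of a tuple of vectors. -/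
def floorTuple {n ℓ : ℕ} (y : Fin ℓ → Fin n → ℝ) : Fin ℓ → Fin n → ℤ := fun k i => ⌊y k i⌋

theorem measurable_floorTuple (n ℓ : ℕ) : Measurable (floorTuple (n := n) (ℓ := ℓ)) :=
  measurable_pi_lambda _ fun k => measurable_pi_lambda _ fun i =>
    Int.measurable_floor.comp ((measurable_pi_apply i).comp (measurable_pi_apply k))

theorem volume_preimage_floorTuple {n ℓ : ℕ} (M : Fin ℓ → Fin n → ℤ) :
    volume (floorTuple ⁻¹' {M}) = 1 := by
  have : floorTuple ⁻¹' {M} = Set.univ.pi fun k => Set.univ.pi fun i =>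
      Set.Ico (M k i : ℝ) (M k i + 1) := by
    ext y
    simp [funext_iff, floorTuple, Int.floor_eq_iff]
  rw [this, volume_pi_pi]
  simp [volume_pi_pi]

theorem tsum_eq_lintegral_floorTuple {n ℓ : ℕ} (F : (Fin ℓ → Fin n → ℤ) → ℝ≥0∞) :
    ∑' M, F M = ∫⁻ y : Fin ℓ → Fin n → ℝ, F (floorTuple y) := by
  have hF : Measurable F := measurable_of_countable F
  rw [← lintegral_map hF (measurable_floorTuple n ℓ), lintegral_countable']
  refine tsum_congr fun M => ?_
  rw [Measure.map_apply (measurable_floorTuple n ℓ) (measurableSet_singleton M),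
    volume_preimage_floorTuple, mul_one]

/-- Rounding of a tuple of vectors to the grid of mesh `ε`. -/
def roundTuple {n ℓ : ℕ} (ε : ℝ) (y : Fin ℓ → Fin n → ℝ) : Fin ℓ → Fin n → ℝ :=
  ε • realTuple (floorTuple (ε⁻¹ • y))

theorem measurable_realTuple (n ℓ : ℕ) : Measurable (realTuple (n := n) (ℓ := ℓ)) :=
  measurable_of_countable _

theorem measurable_roundTuple {n ℓ : ℕ} (ε : ℝ) :
    Measurable (roundTuple (n := n) (ℓ := ℓ) ε) :=
  ((measurable_realTuple n ℓ).comp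
    ((measurable_floorTuple n ℓ).comp (measurable_const_smul ε⁻¹))).const_smul ε

open scoped Classical in
theorem volume_preimage_roundTuple {n ℓ : ℕ} {ε : ℝ} (hε : 0 < ε)
    {B : Set (Fin ℓ → Fin n → ℝ)} (hB : MeasurableSet B) :
    volume (roundTuple ε ⁻¹' B) = ENNReal.ofReal ε ^ (ℓ * n) *
      ∑' M : Fin ℓ → Fin n → ℤ, if ε • realTuple M ∈ B then 1 else 0 := by
  have h1 : roundTuple ε ⁻¹' B =
      (ε⁻¹ • ·) ⁻¹' ((fun y => ε • realTuple (floorTuple y)) ⁻¹' B) := rfl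
  have hmeas : Measurable fun y : Fin ℓ → Fin n → ℝ => ε • realTuple (floorTuple y) :=
    ((measurable_realTuple n ℓ).comp (measurable_floorTuple n ℓ)).const_smul ε
  rw [h1, Measure.addHaar_preimage_smul volume (inv_ne_zero hε.ne'), tsum_eq_lintegral_floorTuple,
    ← lintegral_indicator_one (hmeas hB)]
  congr 1
  simp only [Module.finrank_pi_fintype, Module.finrank_self,
    Finset.sum_const, Finset.card_univ, Fintype.card_fin, smul_eq_mul, mul_one, inv_pow, inv_inv]
  rw [abs_of_pos (by positivity), ENNReal.ofReal_pow hε.le]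

theorem norm_roundTuple_sub_le {n ℓ : ℕ} {ε : ℝ} (hε : 0 < ε) (y : Fin ℓ → Fin n → ℝ) :
    ‖roundTuple ε y - y‖ ≤ ε := by
  refine (pi_norm_le_iff_of_nonneg hε.le).2 fun k => (pi_norm_le_iff_of_nonneg hε.le).2 fun i => ?_
  have h : (roundTuple ε y - y) k i = ε * (⌊ε⁻¹ * y k i⌋ - ε⁻¹ * y k i) := by
    simp only [roundTuple, realTuple, floorTuple, Pi.sub_apply, Pi.smul_apply, smul_eq_mul, mul_sub,
      mul_inv_cancel_left₀ hε.ne']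
  rw [h, norm_mul, Real.norm_of_nonneg hε.le, Real.norm_eq_abs]
  refine mul_le_of_le_one_right hε.le (abs_le.2 ⟨?_, ?_⟩)
  · linarith [Int.lt_floor_add_one (ε⁻¹ * y k i)]
  · linarith [Int.floor_le (ε⁻¹ * y k i)]

theorem tendsto_roundTuple {n ℓ : ℕ} {ε : ℕ → ℝ} (hε : ∀ j, 0 < ε j)
    (hlim : Tendsto ε atTop (𝓝 0)) (y : Fin ℓ → Fin n → ℝ) :
    Tendsto (fun j => roundTuple (ε j) y) atTop (𝓝 y) :=
  tendsto_iff_norm_sub_tendsto_zero.2 <|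
    squeeze_zero (fun _ => norm_nonneg _) (fun j => norm_roundTuple_sub_le (hε j) y) hlim

theorem volume_le_liminf_of_isOpen {n ℓ : ℕ} {ε : ℕ → ℝ} (hε : ∀ j, 0 < ε j)
    (hlim : Tendsto ε atTop (𝓝 0)) {B : Set (Fin ℓ → Fin n → ℝ)} (hB : IsOpen B) :
    volume B ≤ liminf (fun j => volume (roundTuple (ε j) ⁻¹' B)) atTop := by
  have hm : ∀ j, MeasurableSet (roundTuple (ε j) ⁻¹' B) := fun j =>
    measurable_roundTuple (ε j) hB.measurableSet
  simp_rw [← lintegral_indicator_one hB.measurableSet, ← lintegral_indicator_one (hm _)]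
  refine le_trans (lintegral_mono fun y => ?_)
    (lintegral_liminf_le fun j => measurable_one.indicator (hm j))
  by_cases hy : y ∈ B
  · rw [Set.indicator_of_mem hy]
    refine le_liminf_of_le (by isBoundedDefault) ?_
    filter_upwards [(tendsto_roundTuple hε hlim y).eventually (hB.mem_nhds hy)] with j hj
    rw [Set.indicator_of_mem (by exact hj)]
  · rw [Set.indicator_of_notMem hy]
    exact zero_le

theorem limsup_le_volume_of_isCompact {n ℓ : ℕ} {ε : ℕ → ℝ} (hε : ∀ j, 0 < ε j)
    (hlim : Tendsto ε atTop (𝓝 0)) {K : Set (Fin ℓ → Fin n → ℝ)} (hK : IsCompact K) :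
    limsup (fun j => volume (roundTuple (ε j) ⁻¹' K)) atTop ≤ volume K := by
  obtain ⟨C, hC⟩ := hlim.bddAbove_range
  obtain ⟨R, hR⟩ := hK.isBounded.exists_norm_le
  have hm : ∀ j, MeasurableSet (roundTuple (ε j) ⁻¹' K) := fun j =>
    measurable_roundTuple (ε j) hK.measurableSet
  simp_rw [← lintegral_indicator_one hK.measurableSet, ← lintegral_indicator_one (hm _)]
  refine le_trans (limsup_lintegral_le (Metric.closedBall (0 : Fin ℓ → Fin n → ℝ) (R + C)
    |>.indicator 1) (fun j => measurable_one.indicator (hm j)) (fun j => ?_) ?_)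
    (lintegral_mono fun y => ?_)
  · refine Eventually.of_forall fun y => ?_
    refine Set.indicator_le_indicator_of_subset (fun y hy => ?_) (fun _ => zero_le) y
    rw [mem_closedBall_zero_iff]
    have h1 := norm_roundTuple_sub_le (hε j) y
    have h2 := hR _ hy
    have h3 := norm_sub_norm_le y (roundTuple (ε j) y)
    rw [norm_sub_rev] at h3
    linarith [hC ⟨j, rfl⟩]
  · rw [lintegral_indicator_one Metric.isClosed_closedBall.measurableSet]
    exact measure_closedBall_lt_top.ne
  · by_cases hy : y ∈ K
    · rw [Set.indicator_of_mem hy]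
      refine limsup_le_of_le (by isBoundedDefault) (Eventually.of_forall fun j => ?_)
      exact Set.indicator_le_self' (fun _ _ => zero_le) y
    · rw [Set.indicator_of_notMem hy]
      refine limsup_le_of_le (by isBoundedDefault) ?_
      filter_upwards [(tendsto_roundTuple hε hlim y).eventually
        (hK.isClosed.isOpen_compl.mem_nhds hy)] with j hj
      rw [Set.indicator_of_notMem (by exact hj)]

theorem measurePreserving_mulVecTuple {n ℓ : ℕ} (g : SLR n) :
    MeasurePreserving (mulVecTuple (ℓ := ℓ) g.1) volume volume := by
  refine volume_preserving_pi (fun _ => ⟨?_, ?_⟩)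
  · exact (continuous_const.matrix_mulVec continuous_id).measurable
  · have := Real.map_matrix_volume_pi_eq_smul_volume_pi (M := g.1) (by rw [g.2]; simp)
    rw [g.2] at this
    simp only [inv_one, abs_one, ENNReal.ofReal_one, one_smul] at this
    exact this

theorem continuous_mulVecTuple {n ℓ : ℕ} (A : Matrix (Fin n) (Fin n) ℝ) :
    Continuous (mulVecTuple (ℓ := ℓ) A) :=
  continuous_pi fun k => continuous_const.matrix_mulVec (continuous_apply k)

open scoped Classical in
/-- The average over the Hecke neighbours of index `p` of a lattice of the number of linearly
independent tuples in `A`. -/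
def heckeAverage {n ℓ : ℕ} (p : ℕ) (t : ℝ) (A : Set (Fin ℓ → Fin n → ℝ)) (L : LatticeSpace n) :
    ℝ≥0∞ :=
  ((p ^ n - 1 : ℕ) : ℝ≥0∞)⁻¹ * ∑' M : Fin ℓ → Fin n → ℤ,
    if LinearIndependent ℝ (realTuple M) ∧
      mulVecTuple (t⁻¹ • (Quotient.out (α := SLR n) L).1) (realTuple M) ∈ A then
      ((annihilators p M).ncard : ℝ≥0∞) else 0

open scoped Classical in
theorem card_nonzero_forms (n p : ℕ) [Fact p.Prime] :
    Fintype.card {φ : Fin n → ZMod p // φ ≠ 0} = p ^ n - 1 := by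
  rw [Fintype.card_subtype_compl]
  simp [ZMod.card]

theorem two_le_pow_prime {n p : ℕ} (hn : 1 ≤ n) (hp : p.Prime) : 2 ≤ p ^ n :=
  hp.two_le.trans (Nat.le_self_pow (by omega) p)

open scoped Classical in
theorem exists_heckeAverage_eq {n p : ℕ} [Fact p.Prime] (hn : 1 ≤ n) {t : ℝ}
    (ht : t ^ n = p) : ∃ h : {φ : Fin n → ZMod p // φ ≠ 0} → LatticeSpace n,
      (∀ γ : SLZ n, ∃ σ : {φ : Fin n → ZMod p // φ ≠ 0} ≃ {φ : Fin n → ZMod p // φ ≠ 0},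
        ∀ φ, (γ : SLR n) • h φ = h (σ φ)) ∧
      ∀ (ℓ : ℕ) (A : Set (Fin ℓ → Fin n → ℝ)), MeasurableSet A → heckeAverage p t A = fun L =>
        (Fintype.card {φ : Fin n → ZMod p // φ ≠ 0} : ℝ≥0∞)⁻¹ *
          ∑ φ, tupleMeasure ℓ (Quotient.out (α := SLR n) L • h φ) A := by
  choose h hh using fun φ : {φ : Fin n → ZMod p // φ ≠ 0} =>
    exists_latticeOf_eq_congruenceLattice ht φ.2
  have ht0 : t ≠ 0 := by
    rintro rfl
    rw [zero_pow (by omega)] at ht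
    exact (Fact.out : p.Prime).ne_zero (by exact_mod_cast ht.symm)
  refine ⟨h, exists_perm_congruenceLattice hh, fun ℓ A hA => funext fun L => ?_⟩
  rw [sum_tupleMeasure_hecke ht0 hh _ hA, card_nonzero_forms]
  rfl

theorem nonempty_nonzero_forms {n p : ℕ} [Fact p.Prime] (hn : 1 ≤ n) :
    Nonempty {φ : Fin n → ZMod p // φ ≠ 0} :=
  ⟨fun _ => 1, fun h => one_ne_zero (congrFun h ⟨0, hn⟩)⟩

theorem measurable_heckeAverage {n ℓ p : ℕ} [Fact p.Prime] (hn : 1 ≤ n) {t : ℝ}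
    (ht : t ^ n = p) {A : Set (Fin ℓ → Fin n → ℝ)} (hA : MeasurableSet A) :
    Measurable (heckeAverage p t A) := by
  classical
  obtain ⟨h, hperm, heq⟩ := exists_heckeAverage_eq hn ht
  rw [heq ℓ A hA]
  exact (measurable_sum_out_smul hperm
    ((Measure.measurable_coe hA).comp (measurable_tupleMeasure n ℓ))).const_mul _

theorem lintegral_heckeAverage {n ℓ p : ℕ} [Fact p.Prime] (hn : 1 ≤ n) {t : ℝ}
    (ht : t ^ n = p) {A : Set (Fin ℓ → Fin n → ℝ)} (hA : MeasurableSet A)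
    {μ : Measure (LatticeSpace n)} [IsProbabilityMeasure μ]
    (hinv : ∀ g : SLR n, Measure.map (fun x => g • x) μ = μ) :
    ∫⁻ L, heckeAverage p t A L ∂μ = ∫⁻ L, tupleMeasure ℓ L A ∂μ := by
  classical
  obtain ⟨h, hperm, heq⟩ := exists_heckeAverage_eq hn ht
  have := nonempty_nonzero_forms (p := p) hn
  rw [heq ℓ A hA]
  exact (lintegral_eq_lintegral_average hperm hinv
    ((Measure.measurable_coe hA).comp (measurable_tupleMeasure n ℓ))).symm

theorem lintegral_min_tupleMeasure_le {n ℓ p : ℕ} [Fact p.Prime] (hn : 1 ≤ n) {t : ℝ}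
    (ht : t ^ n = p) {A : Set (Fin ℓ → Fin n → ℝ)} (hA : MeasurableSet A)
    {μ : Measure (LatticeSpace n)} [IsProbabilityMeasure μ]
    (hinv : ∀ g : SLR n, Measure.map (fun x => g • x) μ = μ) (T : ℝ≥0∞) :
    ∫⁻ L, min (tupleMeasure ℓ L A) T ∂μ ≤ ∫⁻ L, min (heckeAverage p t A L) T ∂μ := by
  classical
  obtain ⟨h, hperm, heq⟩ := exists_heckeAverage_eq hn ht
  have := nonempty_nonzero_forms (p := p) hn
  have hN : Measurable fun L : LatticeSpace n => tupleMeasure ℓ L A :=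
    (Measure.measurable_coe hA).comp (measurable_tupleMeasure n ℓ)
  rw [lintegral_eq_lintegral_average hperm hinv (hN.min measurable_const), heq ℓ A hA]
  refine lintegral_mono fun L => le_min ?_ ?_
  · exact mul_le_mul_right (Finset.sum_le_sum fun φ _ => min_le_left _ _) _
  · refine (mul_le_mul_right (Finset.sum_le_sum fun φ _ => min_le_right _ _) _).trans ?_
    rw [Finset.sum_const, Finset.card_univ, nsmul_eq_mul, ← mul_assoc, ENNReal.inv_mul_cancel,
      one_mul]
    · exact Nat.cast_ne_zero.2 Fintype.card_ne_zero
    · exact ENNReal.natCast_ne_top _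

theorem mulVecTuple_smul {n ℓ : ℕ} (A : Matrix (Fin n) (Fin n) ℝ) (c : ℝ)
    (x : Fin ℓ → Fin n → ℝ) : mulVecTuple (c • A) x = mulVecTuple A (c • x) := by
  funext k
  simp [mulVecTuple, Matrix.mulVec_smul, Matrix.smul_mulVec]

theorem linearIndependent_const_smul {n ℓ : ℕ} {c : ℝ} (hc : c ≠ 0) {x : Fin ℓ → Fin n → ℝ} :
    LinearIndependent ℝ (c • x) ↔ LinearIndependent ℝ x :=
  LinearIndependent.units_smul_iff x (fun _ => Units.mk0 c hc)

theorem ofReal_pow_inv_root {n ℓ p : ℕ} {t : ℝ} (ht0 : 0 < t) (ht : t ^ n = p) :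
    ENNReal.ofReal t⁻¹ ^ (ℓ * n) = ENNReal.ofReal ((p : ℝ) ^ ℓ)⁻¹ := by
  rw [← ENNReal.ofReal_pow (by positivity), mul_comm, pow_mul, inv_pow, ht, inv_pow]

theorem inv_mul_natCast_eq_ofReal {n p c : ℕ} (hn : 1 ≤ n) (hp : p.Prime) :
    ((p ^ n - 1 : ℕ) : ℝ≥0∞)⁻¹ * (c : ℝ≥0∞) = ENNReal.ofReal (((p : ℝ) ^ n - 1)⁻¹ * c) := by
  have h2 := two_le_pow_prime hn hp
  have h3 : (((p ^ n - 1 : ℕ) : ℕ) : ℝ) = (p : ℝ) ^ n - 1 := by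
    rw [Nat.cast_sub (by omega)]; simp
  have h4 : (0 : ℝ) < ((p ^ n - 1 : ℕ) : ℝ) := by exact_mod_cast (by omega : 0 < p ^ n - 1)
  rw [← h3, ENNReal.ofReal_mul (by positivity), ENNReal.ofReal_inv_of_pos h4,
    ENNReal.ofReal_natCast, ENNReal.ofReal_natCast]

theorem mul_volume_le_heckeAverage {n ℓ p : ℕ} [Fact p.Prime] (hℓ : ℓ < n) {t : ℝ} (ht0 : 0 < t)
    (ht : t ^ n = p) {A : Set (Fin ℓ → Fin n → ℝ)} (hA : MeasurableSet A) (L : LatticeSpace n) :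
    ENNReal.ofReal (1 - (p : ℝ)⁻¹) * volume (roundTuple t⁻¹ ⁻¹'
      (mulVecTuple (Quotient.out (α := SLR n) L).1 ⁻¹' A ∩
        {x | LinearIndependent ℝ x})) ≤ heckeAverage p t A L := by
  classical
  have hp : p.Prime := Fact.out
  rw [volume_preimage_roundTuple (inv_pos.2 ht0)
    (((continuous_mulVecTuple _).measurable hA).inter (measurableSet_linearIndependent n ℓ)),
    heckeAverage, ofReal_pow_inv_root ht0 ht, ← mul_assoc, ← ENNReal.tsum_mul_left,
    ← ENNReal.tsum_mul_left]
  refine ENNReal.tsum_le_tsum fun M => ?_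
  simp only [mulVecTuple_smul, Set.mem_inter_iff, Set.mem_preimage, Set.mem_ofPred_eq,
    linearIndependent_const_smul (inv_ne_zero ht0.ne')]
  split_ifs with h1 h2
  · rw [mul_one, inv_mul_natCast_eq_ofReal (by omega) hp, ← ENNReal.ofReal_mul]
    · refine ENNReal.ofReal_le_ofReal ?_
      have hp1 : (1 : ℝ) < p := by exact_mod_cast hp.one_lt
      have hpn : (p : ℝ) ^ n = (p : ℝ) ^ ℓ * (p : ℝ) ^ (n - ℓ) := by
        rw [← pow_add]; congr 1; omega
      have hc : (p : ℝ) ^ (n - ℓ) ≤ ((annihilators p M).ncard : ℝ) + 1 := by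
        exact_mod_cast pow_le_ncard_annihilators (p := p) M
      have hq : (p : ℝ) ≤ (p : ℝ) ^ (n - ℓ) := le_self_pow₀ hp1.le (by omega)
      have hP : (1 : ℝ) ≤ (p : ℝ) ^ ℓ := one_le_pow₀ hp1.le
      rw [hpn]
      generalize (p : ℝ) ^ ℓ = P at *
      generalize (p : ℝ) ^ (n - ℓ) = q at *
      generalize ((annihilators p M).ncard : ℝ) = c at *
      have hPq : 0 < P * q - 1 := by nlinarith
      rw [← div_eq_mul_inv, ← div_eq_inv_mul, div_le_div_iff₀ (by linarith) hPq]
      have h5 : (1 - (p : ℝ)⁻¹) * (P * q - 1) ≤ (1 - (p : ℝ)⁻¹) * (P * q) := by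
        have : (0 : ℝ) ≤ 1 - (p : ℝ)⁻¹ := sub_nonneg.2 (inv_le_one_of_one_le₀ hp1.le)
        nlinarith
      have h6 : P ≤ (p : ℝ)⁻¹ * (P * q) := by
        rw [← div_eq_inv_mul, le_div_iff₀ (by linarith)]
        nlinarith
      nlinarith
    · exact sub_nonneg.2 (inv_le_one_of_one_le₀ (by exact_mod_cast hp.one_lt.le))
  · exact absurd ⟨h1.2, h1.1⟩ h2
  · simp
  · simp

theorem heckeAverage_le_volume {n ℓ p : ℕ} [Fact p.Prime] (hℓ : ℓ < n) {t : ℝ} (ht0 : 0 < t)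
    (ht : t ^ n = p) {A : Set (Fin ℓ → Fin n → ℝ)} (hA : MeasurableSet A) (L : LatticeSpace n)
    {C : ℝ} (hC0 : 0 ≤ C)
    (hC : ∀ x ∈ mulVecTuple (Quotient.out (α := SLR n) L).1 ⁻¹' A, ‖x‖ ≤ C)
    (ht1 : 1 ≤ t) (htC : ℓ.factorial * C ^ ℓ < t) :
    heckeAverage p t A L ≤ volume (roundTuple t⁻¹ ⁻¹'
      (mulVecTuple (Quotient.out (α := SLR n) L).1 ⁻¹' A)) := by
  classical
  have hp : p.Prime := Fact.out
  rw [volume_preimage_roundTuple (inv_pos.2 ht0) ((continuous_mulVecTuple _).measurable hA),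
    heckeAverage, ofReal_pow_inv_root ht0 ht, ← ENNReal.tsum_mul_left, ← ENNReal.tsum_mul_left]
  refine ENNReal.tsum_le_tsum fun M => ?_
  simp only [mulVecTuple_smul, Set.mem_preimage]
  split_ifs with h1 h2
  · rw [mul_one, inv_mul_natCast_eq_ofReal (by omega) hp]
    have hb : ∀ k i, |M k i| ≤ ⌊C * t⌋ := fun k i => by
      have h3 := ((norm_le_pi_norm ((t⁻¹ • realTuple M) k) i).trans
        (norm_le_pi_norm (t⁻¹ • realTuple M) k)).trans (hC _ h2)
      simp only [Pi.smul_apply, realTuple, smul_eq_mul, norm_mul, norm_inv, Real.norm_eq_abs,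
        abs_of_pos ht0] at h3
      rw [inv_mul_le_iff₀ ht0] at h3
      rw [Int.le_floor]
      push_cast
      linarith
    have hbp : (ℓ.factorial : ℤ) * ⌊C * t⌋ ^ ℓ < p := by
      have h3 : ((⌊C * t⌋ : ℤ) : ℝ) ^ ℓ ≤ (C * t) ^ ℓ := by
        refine pow_le_pow_left₀ ?_ (Int.floor_le _) ℓ
        exact_mod_cast Int.floor_nonneg.2 (mul_nonneg hC0 ht0.le)
      have h4 : (ℓ.factorial : ℝ) * (⌊C * t⌋ : ℤ) ^ ℓ < p := calc
        (ℓ.factorial : ℝ) * (⌊C * t⌋ : ℤ) ^ ℓ ≤ ℓ.factorial * (C * t) ^ ℓ := by gcongr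
        _ = ℓ.factorial * C ^ ℓ * t ^ ℓ := by rw [mul_pow, mul_assoc]
        _ < t * t ^ ℓ := by gcongr
        _ = t ^ (ℓ + 1) := (pow_succ' t ℓ).symm
        _ ≤ t ^ n := pow_le_pow_right₀ ht1 hℓ
        _ = p := ht
      exact_mod_cast h4
    refine ENNReal.ofReal_le_ofReal ?_
    have hp1 : (1 : ℝ) < p := by exact_mod_cast hp.one_lt
    have hpn : (p : ℝ) ^ n = (p : ℝ) ^ ℓ * (p : ℝ) ^ (n - ℓ) := by
      rw [← pow_add]; congr 1; omega
    have hc : ((annihilators p M).ncard : ℝ) + 1 = (p : ℝ) ^ (n - ℓ) := by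
      exact_mod_cast ncard_annihilators_of_bound h1.1 hb hbp
    have hq : (p : ℝ) ≤ (p : ℝ) ^ (n - ℓ) := le_self_pow₀ hp1.le (by omega)
    have hP : (1 : ℝ) ≤ (p : ℝ) ^ ℓ := one_le_pow₀ hp1.le
    rw [hpn]
    generalize (p : ℝ) ^ ℓ = P at *
    generalize (p : ℝ) ^ (n - ℓ) = q at *
    generalize ((annihilators p M).ncard : ℝ) = c at *
    have hPq : 0 < P * q - 1 := by nlinarith
    rw [← div_eq_inv_mul, ← one_div, div_le_div_iff₀ hPq (by linarith)]
    nlinarith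
  · exact absurd h1.2 h2
  · simp
  · simp

theorem exists_seq_prime_root {n : ℕ} (hn : 1 ≤ n) : ∃ (p : ℕ → ℕ) (t : ℕ → ℝ),
    (∀ j, (p j).Prime) ∧ (∀ j, 0 < t j) ∧ (∀ j, t j ^ n = p j) ∧
      Tendsto p atTop atTop ∧ Tendsto t atTop atTop := by
  choose p hjp hp using Nat.exists_infinite_primes
  have hlim : Tendsto p atTop atTop := tendsto_atTop_mono hjp tendsto_id
  refine ⟨p, fun j => (p j : ℝ) ^ (n : ℝ)⁻¹, hp, fun j => ?_, fun j => ?_, hlim, ?_⟩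
  · exact Real.rpow_pos_of_pos (by exact_mod_cast (hp j).pos) _
  · exact Real.rpow_inv_natCast_pow (Nat.cast_nonneg _) (by omega)
  · exact (tendsto_rpow_atTop (by positivity)).comp (tendsto_natCast_atTop_atTop.comp hlim)

theorem volume_le_lintegral_tupleMeasure {n ℓ : ℕ} (hℓ : ℓ < n) {μ : Measure (LatticeSpace n)}
    [IsProbabilityMeasure μ] (hinv : ∀ g : SLR n, Measure.map (fun x => g • x) μ = μ)
    {O : Set (Fin ℓ → Fin n → ℝ)} (hO : IsOpen O) :
    volume O ≤ ∫⁻ L, tupleMeasure ℓ L O ∂μ := by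
  have hn : 1 ≤ n := by omega
  obtain ⟨p, t, hp, ht0, ht, hplim, htlim⟩ := exists_seq_prime_root hn
  have := fun j => Fact.mk (hp j)
  have hpoint : ∀ L : LatticeSpace n,
      volume O ≤ liminf (fun j => heckeAverage (p j) (t j) O L) atTop := by
    intro L
    set g := Quotient.out (α := SLR n) L with hg
    set B := mulVecTuple g.1 ⁻¹' O ∩ {x | LinearIndependent ℝ x} with hB
    have hBopen : IsOpen B := (hO.preimage (continuous_mulVecTuple _)).inter
      isOpen_setOfPred_linearIndependent
    have hvol : volume O = volume B := by
      rw [hB, ← (measurePreserving_mulVecTuple g).measure_preimage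
        hO.measurableSet.nullMeasurableSet]
      refine (measure_congr (inter_ae_eq_left_of_ae_eq_univ ?_)).symm
      exact eventuallyEq_univ.2 (ae_linearIndependent hℓ.le)
    have hu : liminf (fun j => ENNReal.ofReal (1 - (p j : ℝ)⁻¹)) atTop = 1 := by
      refine Tendsto.liminf_eq ?_
      have h1 : Tendsto (fun j => 1 - (p j : ℝ)⁻¹) atTop (𝓝 (1 - 0)) :=
        tendsto_const_nhds.sub (tendsto_natCast_atTop_atTop.comp hplim).inv_tendsto_atTop
      simpa using ENNReal.tendsto_ofReal h1
    calc volume O = 1 * volume B := by rw [hvol, one_mul]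
      _ ≤ liminf (fun j => ENNReal.ofReal (1 - (p j : ℝ)⁻¹)) atTop *
          liminf (fun j => volume (roundTuple (t j)⁻¹ ⁻¹' B)) atTop := by
        rw [hu]
        gcongr
        exact volume_le_liminf_of_isOpen (fun j => inv_pos.2 (ht0 j)) htlim.inv_tendsto_atTop hBopen
      _ ≤ _ := ENNReal.le_liminf_mul
      _ ≤ _ := liminf_le_liminf (Eventually.of_forall fun j =>
        mul_volume_le_heckeAverage hℓ (ht0 j) (ht j) hO.measurableSet L)
  calc volume O = ∫⁻ _, volume O ∂μ := by simp
    _ ≤ ∫⁻ L, liminf (fun j => heckeAverage (p j) (t j) O L) atTop ∂μ := lintegral_mono hpoint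
    _ ≤ liminf (fun j => ∫⁻ L, heckeAverage (p j) (t j) O L ∂μ) atTop :=
      lintegral_liminf_le fun j => measurable_heckeAverage hn (ht j) hO.measurableSet
    _ = ∫⁻ L, tupleMeasure ℓ L O ∂μ := by
      simp_rw [lintegral_heckeAverage hn (ht _) hO.measurableSet hinv]
      exact liminf_const _

theorem lintegral_tupleMeasure_le_volume {n ℓ : ℕ} (hℓ : ℓ < n) {μ : Measure (LatticeSpace n)}
    [IsProbabilityMeasure μ] (hinv : ∀ g : SLR n, Measure.map (fun x => g • x) μ = μ)
    {K : Set (Fin ℓ → Fin n → ℝ)} (hK : IsCompact K) :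
    ∫⁻ L, tupleMeasure ℓ L K ∂μ ≤ volume K := by
  have hn : 1 ≤ n := by omega
  obtain ⟨p, t, hp, ht0, ht, hplim, htlim⟩ := exists_seq_prime_root hn
  have := fun j => Fact.mk (hp j)
  have hpoint : ∀ L : LatticeSpace n,
      limsup (fun j => heckeAverage (p j) (t j) K L) atTop ≤ volume K := by
    intro L
    set g := Quotient.out (α := SLR n) L with hg
    set B := mulVecTuple g.1 ⁻¹' K with hB
    have hBeq : B = mulVecTuple (g⁻¹ : SLR n).1 '' K := by
      have h1 : ∀ (a b : SLR n), a * b = 1 → ∀ x : Fin ℓ → Fin n → ℝ,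
          mulVecTuple a.1 (mulVecTuple b.1 x) = x := fun a b hab x => by
        funext k
        simp only [mulVecTuple, Matrix.mulVec_mulVec, ← Matrix.SpecialLinearGroup.coe_mul, hab,
          Matrix.SpecialLinearGroup.coe_one, Matrix.one_mulVec]
      exact (congrFun (Set.image_eq_preimage_of_inverse (h1 _ _ (mul_inv_cancel g))
        (h1 _ _ (inv_mul_cancel g))) K).symm
    have hBc : IsCompact B := hBeq ▸ hK.image (continuous_mulVecTuple _)
    have hvol : volume B = volume K :=
      (measurePreserving_mulVecTuple g).measure_preimage hK.measurableSet.nullMeasurableSet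
    obtain ⟨C, hC0, hC⟩ := hBc.isBounded.exists_pos_norm_le
    rw [← hvol]
    refine le_trans (limsup_le_limsup ?_) (limsup_le_volume_of_isCompact
      (fun j => inv_pos.2 (ht0 j)) htlim.inv_tendsto_atTop hBc)
    filter_upwards [htlim.eventually_ge_atTop 1,
      htlim.eventually_gt_atTop (ℓ.factorial * C ^ ℓ)] with j h1 h2
    exact heckeAverage_le_volume hℓ (ht0 j) (ht j) hK.measurableSet L hC0.le hC h1 h2
  have hN : Measurable fun L : LatticeSpace n => tupleMeasure ℓ L K :=
    (Measure.measurable_coe hK.measurableSet).comp (measurable_tupleMeasure n ℓ)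
  have htrunc : ∀ T : ℕ, ∫⁻ L, min (tupleMeasure ℓ L K) T ∂μ ≤ volume K := by
    intro T
    calc ∫⁻ L, min (tupleMeasure ℓ L K) T ∂μ
        ≤ limsup (fun j => ∫⁻ L, min (heckeAverage (p j) (t j) K L) T ∂μ) atTop :=
          le_limsup_of_frequently_le (Eventually.of_forall fun j =>
            lintegral_min_tupleMeasure_le hn (ht j) hK.measurableSet hinv _).frequently
      _ ≤ ∫⁻ L, limsup (fun j => min (heckeAverage (p j) (t j) K L) T) atTop ∂μ :=
          limsup_lintegral_le (fun _ => T)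
            (fun j => (measurable_heckeAverage hn (ht j) hK.measurableSet).min measurable_const)
            (fun j => Eventually.of_forall fun L => min_le_right _ _)
            (by rw [lintegral_const, measure_univ, mul_one]; exact ENNReal.natCast_ne_top T)
      _ ≤ ∫⁻ _, volume K ∂μ := lintegral_mono fun L =>
          (limsup_le_limsup (Eventually.of_forall fun j => min_le_left _ _)).trans (hpoint L)
      _ = volume K := by rw [lintegral_const, measure_univ, mul_one]
  have hsup : ∀ L : LatticeSpace n,
      tupleMeasure ℓ L K = ⨆ T : ℕ, min (tupleMeasure ℓ L K) T := fun L => by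
    rw [← inf_iSup_eq, ENNReal.iSup_natCast, inf_top_eq]
  rw [lintegral_congr hsup, lintegral_iSup (fun T => hN.min measurable_const)
    (fun T T' h L => min_le_min_left _ (by exact_mod_cast h))]
  exact iSup_le htrunc

theorem bind_tupleMeasure {n ℓ : ℕ} (hℓ : ℓ < n) {μ : Measure (LatticeSpace n)}
    [IsProbabilityMeasure μ] (hinv : ∀ g : SLR n, Measure.map (fun x => g • x) μ = μ) :
    μ.bind (tupleMeasure ℓ) = volume := by
  have hbind : ∀ {A}, MeasurableSet A → μ.bind (tupleMeasure ℓ) A = ∫⁻ L, tupleMeasure ℓ L A ∂μ :=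
    fun hA => Measure.bind_apply hA (measurable_tupleMeasure n ℓ).aemeasurable
  have hle : ∀ {K}, IsCompact K → μ.bind (tupleMeasure ℓ) K ≤ volume K := fun hK => by
    rw [hbind hK.measurableSet]
    exact lintegral_tupleMeasure_le_volume hℓ hinv hK
  have : IsFiniteMeasureOnCompacts (μ.bind (tupleMeasure ℓ)) :=
    ⟨fun K hK => (hle hK).trans_lt hK.measure_lt_top⟩
  have : (volume : Measure (Fin ℓ → Fin n → ℝ)).Regular :=
    Measure.Regular.of_sigmaCompactSpace_of_isLocallyFiniteMeasure _
  refine Measure.OuterRegular.ext_isOpen fun O hO => le_antisymm ?_ ?_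
  · rw [hO.measure_eq_iSup_isCompact]
    exact iSup₂_le fun K hKO => iSup_le fun hK => (hle hK).trans (measure_mono hKO)
  · rw [hbind hO.measurableSet]
    exact volume_le_lintegral_tupleMeasure hℓ hinv hO

end

theorem card_filter_range_eq {n ℓ : ℕ} {V : Set (Fin n → ℝ)} (hV : (indepTuples ℓ V).Finite)
    {x : Fin ℓ → Fin n → ℝ} (hx : x ∈ indepTuples ℓ V)
    [DecidablePred fun y : Fin ℓ → Fin n → ℝ => Set.range y = Set.range x] :
    (hV.toFinset.filter fun y => Set.range y = Set.range x).card = ℓ.factorial := by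
  classical
  have hinj : Function.Injective fun σ : Equiv.Perm (Fin ℓ) => x ∘ σ := fun σ τ h =>
    Equiv.ext fun k => hx.2.injective (congrFun h k)
  have : (hV.toFinset.filter fun y => Set.range y = Set.range x) =
      Finset.univ.image fun σ : Equiv.Perm (Fin ℓ) => x ∘ σ := by
    ext y
    simp only [Finset.mem_filter, Set.Finite.mem_toFinset, Finset.mem_image, Finset.mem_univ,
      true_and]
    constructor
    · rintro ⟨hy, hyx⟩
      refine ⟨(Equiv.ofInjective y hy.2.injective).trans
        ((Equiv.setCongr hyx).trans (Equiv.ofInjective x hx.2.injective).symm), funext fun k => ?_⟩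
      simp [Equiv.apply_ofInjective_symm]
    · rintro ⟨σ, rfl⟩
      exact ⟨⟨fun k => hx.1 _, hx.2.comp σ σ.injective⟩, σ.surjective.range_comp x⟩
  rw [this, Finset.card_image_of_injective _ hinj, Finset.card_univ, Fintype.card_perm,
    Fintype.card_fin]

theorem indepSet_range {n ℓ : ℕ} {x : Fin ℓ → Fin n → ℝ} (hx : LinearIndependent ℝ x) :
    indepSet (Set.range x) :=
  hx.linearIndepOn_id

theorem ncard_range_of_linearIndependent {n ℓ : ℕ} {x : Fin ℓ → Fin n → ℝ}
    (hx : LinearIndependent ℝ x) : (Set.range x).ncard = ℓ := by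
  rw [← Set.image_univ, Set.ncard_image_of_injective _ hx.injective, Set.ncard_univ, Nat.card_fin]

theorem exists_mem_indepTuples_range_eq {n : ℕ} {V X : Set (Fin n → ℝ)} (hXV : X ⊆ V)
    (hX : X.Finite) (hind : indepSet X) : ∃ x ∈ indepTuples X.ncard V, Set.range x = X := by
  have := hX.to_subtype
  let e := (Finite.equivFinOfCardEq (α := X) (Nat.card_coe_set_eq X)).symm
  refine ⟨Subtype.val ∘ e, ⟨fun k => hXV (e k).2, hind.comp e e.injective⟩, ?_⟩
  rw [e.surjective.range_comp, Subtype.range_coe]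

theorem finsum_subsets_eq_sum_indepTuples {n : ℕ} {V : Set (Fin n → ℝ)}
    (hV : ∀ ℓ < n, (indepTuples ℓ V).Finite) {f : Set (Fin n → ℝ) → ℝ}
    (hsupp : ∀ X : Set (Fin n → ℝ), n ≤ X.ncard → f X = 0)
    (hfin : ∀ X : Set (Fin n → ℝ), X.Infinite → f X = 0) :
    ∑ᶠ X ∈ {Y : Set (Fin n → ℝ) | Y ⊆ V}, f X * iota X =
      ∑ ℓ ∈ Finset.range n, (1 / (ℓ.factorial : ℝ)) *
        ∑ᶠ x ∈ indepTuples ℓ V, f (Set.range x) := by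
  classical
  have hfinset : ∀ ℓ, ∃ T : Finset (Fin ℓ → Fin n → ℝ), ℓ < n → (T : Set _) = indepTuples ℓ V := by
    intro ℓ
    by_cases h : ℓ < n
    · exact ⟨(hV ℓ h).toFinset, fun _ => (hV ℓ h).coe_toFinset⟩
    · exact ⟨∅, fun h' => absurd h' h⟩
  choose T hT using hfinset
  have hmem : ∀ {ℓ x}, ℓ < n → (x ∈ T ℓ ↔ x ∈ indepTuples ℓ V) := fun h => by
    rw [← hT _ h, Finset.mem_coe]
  rw [finsum_mem_eq_sum_of_inter_support_eq _
    (t := (Finset.range n).biUnion fun ℓ => (T ℓ).image Set.range), Finset.sum_biUnion]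
  · refine Finset.sum_congr rfl fun ℓ hℓ => ?_
    rw [Finset.mem_range] at hℓ
    rw [← hT ℓ hℓ, finsum_mem_coe_finset, Finset.sum_comp f Set.range, Finset.mul_sum]
    refine Finset.sum_congr rfl fun X hX => ?_
    obtain ⟨x, hx, rfl⟩ := Finset.mem_image.1 hX
    rw [hmem hℓ] at hx
    have hTf : T ℓ = (hV ℓ hℓ).toFinset := by
      ext y; rw [hmem hℓ, Set.Finite.mem_toFinset]
    rw [iota, if_pos (indepSet_range hx.2), hTf, card_filter_range_eq _ hx, nsmul_eq_mul,
      mul_one, ← mul_assoc, one_div_mul_cancel (by exact_mod_cast ℓ.factorial_ne_zero), one_mul]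
  · intro ℓ hℓ ℓ' hℓ' hne
    refine Finset.disjoint_left.2 fun X hX hX' => hne ?_
    obtain ⟨x, hx, rfl⟩ := Finset.mem_image.1 hX
    obtain ⟨x', hx', hxx⟩ := Finset.mem_image.1 hX'
    rw [hmem (by simpa using hℓ)] at hx
    rw [hmem (by simpa using hℓ')] at hx'
    rw [← ncard_range_of_linearIndependent hx.2, ← hxx, ncard_range_of_linearIndependent hx'.2]
  · ext X
    simp only [Set.mem_inter_iff, Set.mem_ofPred_eq, Function.mem_support, Finset.coe_biUnion,
      Finset.coe_image, Set.mem_iUnion, Set.mem_image, Finset.mem_coe, Finset.mem_range]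
    refine and_congr_left fun h0 => ⟨fun hXV => ?_, ?_⟩
    · have hXfin : X.Finite := by
        by_contra h
        exact h0 (by rw [hfin X h, zero_mul])
      have hcard : X.ncard < n := by
        by_contra h
        exact h0 (by rw [hsupp X (not_lt.1 h), zero_mul])
      have hind : indepSet X := by
        by_contra h
        exact h0 (by rw [iota, if_neg h, mul_zero])
      obtain ⟨x, hx, hxX⟩ := exists_mem_indepTuples_range_eq hXV hXfin hind
      exact ⟨_, hcard, x, (hmem hcard).2 hx, hxX⟩
    · rintro ⟨ℓ, hℓ, x, hx, rfl⟩
      rw [hmem hℓ] at hx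
      exact Set.range_subset_iff.2 hx.1

theorem finite_indepTuples_of_tupleMeasure_lt_top {n ℓ : ℕ} {L : LatticeSpace n}
    {S : Set (Fin n → ℝ)} (hS : MeasurableSet S)
    (h : tupleMeasure ℓ L (Set.univ.pi fun _ => S) < ∞) :
    (indepTuples ℓ (latticeOf L ∩ S)).Finite := by
  have hpi : MeasurableSet (Set.univ.pi fun _ : Fin ℓ => S) := MeasurableSet.univ_pi fun _ => hS
  rw [← lintegral_indicator_one hpi, lintegral_tupleMeasure L (measurable_one.indicator hpi)] at h
  refine ((ENNReal.finite_const_le_of_tsum_ne_top h.ne one_ne_zero).image Subtype.val).subset ?_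
  rintro x ⟨hx, hli⟩
  refine ⟨⟨x, fun k => (hx k).1, hli⟩, ?_, rfl⟩
  have hxS : x ∈ Set.univ.pi fun _ : Fin ℓ => S := fun k _ => (hx k).2
  simp [Set.indicator_of_mem hxS]

theorem integral_tupleMeasure_eq_finsum {n ℓ : ℕ} {L : LatticeSpace n} {S : Set (Fin n → ℝ)}
    {F : (Fin ℓ → Fin n → ℝ) → ℝ} (hfin : (indepTuples ℓ (latticeOf L ∩ S)).Finite)
    (hF : Integrable ((Set.univ.pi fun _ => S).indicator F) (tupleMeasure ℓ L)) :
    ∫ x, (Set.univ.pi fun _ => S).indicator F x ∂(tupleMeasure ℓ L) =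
      ∑ᶠ x ∈ indepTuples ℓ (latticeOf L ∩ S), F x := by
  have hset : ∀ x, (indepTuples ℓ (latticeOf L)).indicator
      ((Set.univ.pi fun _ => S).indicator F) x =
      (indepTuples ℓ (latticeOf L ∩ S)).indicator F x := fun x => by
    rw [Set.indicator_indicator]
    congr 1
    ext y
    exact ⟨fun h => ⟨fun k => ⟨h.1.1 k, h.2 k trivial⟩, h.1.2⟩,
      fun h => ⟨⟨fun k => (h.1 k).1, h.2⟩, fun k _ => (h.1 k).2⟩⟩
  rw [tupleMeasure] at hF ⊢
  rw [integral_sum_measure hF]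
  simp_rw [integral_dirac]
  rw [tsum_subtype (indepTuples ℓ (latticeOf L)) ((Set.univ.pi fun _ => S).indicator F),
    tsum_congr hset, tsum_eq_finsum (hfin.subset Set.support_indicator_subset), finsum_mem_def]

theorem integrable_and_integral_finsum_indepTuples {n ℓ : ℕ} (hℓ : ℓ < n) {S : Set (Fin n → ℝ)}
    (hS : MeasurableSet S) (hSfin : volume S < ∞) {μ : Measure (LatticeSpace n)}
    [IsProbabilityMeasure μ] (hinv : ∀ g : SLR n, Measure.map (fun x => g • x) μ = μ)
    {F : (Fin ℓ → Fin n → ℝ) → ℝ} (hF : Measurable F) {M : ℝ} (hM : ∀ x, |F x| ≤ M) :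
    (∀ᵐ L ∂μ, (indepTuples ℓ (latticeOf L ∩ S)).Finite) ∧
      Integrable (fun L => ∑ᶠ x ∈ indepTuples ℓ (latticeOf L ∩ S), F x) μ ∧
      ∫ L, ∑ᶠ x ∈ indepTuples ℓ (latticeOf L ∩ S), F x ∂μ =
        ∫ x in Set.univ.pi (fun _ : Fin ℓ => S), F x := by
  have hpi : MeasurableSet (Set.univ.pi fun _ : Fin ℓ => S) := MeasurableSet.univ_pi fun _ => hS
  have hvol : volume (Set.univ.pi fun _ : Fin ℓ => S) < ∞ := by
    rw [volume_pi_pi]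
    exact ENNReal.prod_lt_top fun _ _ => hSfin
  let κ : ProbabilityTheory.Kernel (LatticeSpace n) (Fin ℓ → Fin n → ℝ) :=
    ⟨tupleMeasure ℓ, measurable_tupleMeasure n ℓ⟩
  have hbind : μ.bind κ = volume := bind_tupleMeasure hℓ hinv
  have hcomp : (κ.comp (ProbabilityTheory.Kernel.const Unit μ)) () = volume := by
    rw [← Measure.comp_eq_comp_const_apply, hbind]
  have hfinite : ∀ᵐ L ∂μ, (indepTuples ℓ (latticeOf L ∩ S)).Finite := by
    have hlt : ∫⁻ L, κ L (Set.univ.pi fun _ : Fin ℓ => S) ∂μ ≠ ∞ := by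
      rw [← Measure.bind_apply hpi κ.aemeasurable, hbind]
      exact hvol.ne
    filter_upwards [ae_lt_top (κ.measurable_coe hpi) hlt] with L hL
    exact finite_indepTuples_of_tupleMeasure_lt_top hS hL
  have hI : Integrable ((Set.univ.pi fun _ : Fin ℓ => S).indicator F) volume := by
    rw [integrable_indicator_iff hpi]
    exact Measure.integrableOn_of_bounded hvol.ne hF.aestronglyMeasurable
      (Filter.Eventually.of_forall hM)
  have hae : (fun L => ∫ x, (Set.univ.pi fun _ : Fin ℓ => S).indicator F x ∂(κ L)) =ᵐ[μ]
      fun L => ∑ᶠ x ∈ indepTuples ℓ (latticeOf L ∩ S), F x := by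
    filter_upwards [hfinite, Measure.ae_integrable_of_integrable_comp (hbind ▸ hI)] with L hL hL'
    exact integral_tupleMeasure_eq_finsum hL hL'
  have hIc := hI
  rw [← hcomp] at hIc
  refine ⟨hfinite, ?_, ?_⟩
  · exact (hIc.integral_comp).congr hae
  · rw [← integral_indicator hpi, ← integral_congr_ae hae, ← hcomp,
      ProbabilityTheory.Kernel.integral_comp hIc]
    rfl

/-- Let `S ⊆ ℝⁿ` be a Borel set with `S ∩ (-S) = ∅` and `0 < Vol(S) < ∞`, let `μ` be an
`SL(n,ℝ)`-invariant Borel probability measure on the space of covolume-one lattices,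
and let `f` be a bounded Borel function on the finite subsets of `S` vanishing on sets
of cardinality at least `n`. Then the `μ`-average of `Σ_{X ⊆ L ∩ S} f(X)·ι(X)` equals
`Σ_{ℓ=0}^{n-1} (1/ℓ!) ∫_{Sˡ} f({x₁, …, x_ℓ}) dx₁⋯dx_ℓ`. -/
theorem lattice_sum_eq_integral_sum
    (n : ℕ) (hn : 1 ≤ n)
    (S : Set (Fin n → ℝ)) (hSmeas : MeasurableSet S)
    (hSsym : S ∩ (-S) = ∅) (hS0 : 0 < volume S) (hSfin : volume S < ⊤)
    (μ : Measure (LatticeSpace n)) (hprob : IsProbabilityMeasure μ)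
    (hinv : ∀ g : SLR n, Measure.map (fun x => g • x) μ = μ)
    (f : Set (Fin n → ℝ) → ℝ)
    (hbdd : ∃ M : ℝ, ∀ X, |f X| ≤ M)
    (hmeas : ∀ m : ℕ, Measurable fun x : Fin m → (Fin n → ℝ) => f (Set.range x))
    (hsupp : ∀ X : Set (Fin n → ℝ), n ≤ X.ncard → f X = 0)
    (hfin : ∀ X : Set (Fin n → ℝ), X.Infinite → f X = 0) :
    ∫ L, (∑ᶠ X ∈ {Y : Set (Fin n → ℝ) | Y ⊆ latticeOf L ∩ S}, f X * iota X) ∂μ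
      = ∑ ℓ ∈ Finset.range n, (1 / (Nat.factorial ℓ : ℝ)) *
          ∫ x in Set.univ.pi (fun _ : Fin ℓ => S), f (Set.range x) := by
  obtain ⟨M, hM⟩ := hbdd
  have key := fun (ℓ : ℕ) (hℓ : ℓ < n) => integrable_and_integral_finsum_indepTuples hℓ hSmeas
    hSfin hinv (hmeas ℓ) fun x => hM (Set.range x)
  have hfinite : ∀ᵐ L ∂μ, ∀ ℓ < n, (indepTuples ℓ (latticeOf L ∩ S)).Finite := by
    refine ae_all_iff.2 fun ℓ => ?_
    by_cases hℓ : ℓ < n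
    · filter_upwards [(key ℓ hℓ).1] with L hL _ using hL
    · exact Filter.Eventually.of_forall fun _ h => absurd h hℓ
  rw [integral_congr_ae (hfinite.mono fun L hL => finsum_subsets_eq_sum_indepTuples hL hsupp hfin),
    integral_finsetSum _ fun ℓ hℓ => (key ℓ (Finset.mem_range.1 hℓ)).2.1.const_mul _]
  refine Finset.sum_congr rfl fun ℓ hℓ => ?_
  rw [integral_const_mul, (key ℓ (Finset.mem_range.1 hℓ)).2.2]
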